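/- arXiv:1201.0518 — 3 statements merged into one kernel-verified Lean document; each statement's English description precedes it below -/
import Mathlib

section
/- Fix an integer l ≥ 1 and a real number q > 1, and set t := q^{−1/2}. If (a, b) and (a′, b′) are two pairs of l-tuples of nonzero complex numbers such that a and a′ are GL-regular and b and b′ are B-regular, then A_A(t; a, b) = A_A(t; a′, b′). In other words, the Weyl-group sum A_A(t; a, b) is independent of the regular pair (a, b). -/
noncomputable section

namespace GrossPrasadCaseA

/-- The group `W_l = (ℤ/2)^l ⋊ S_l` of signed permutations, encoded as a pair of a sign
vector and a permutation. -/
abbrev SignedPerm (l : ℕ) := (Fin l → Bool) × Equiv.Perm (Fin l)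

/-- The action of a signed permutation on an `l`-tuple: permute and invert marked
coordinates, `((ε,σ)·a)_k = a_{σ⁻¹ k}^{ε_k}`. -/
def sact {l : ℕ} (w : SignedPerm l) (a : Fin l → ℂ) : Fin l → ℂ :=
  fun k => if w.1 k then (a (w.2⁻¹ k))⁻¹ else a (w.2⁻¹ k)

/-- The numerator `b(Ξ,ξ)⁻¹`-type product of Case A. -/
def bA (l : ℕ) (t : ℂ) (a b : Fin l → ℂ) : ℂ :=
  (∏ j : Fin l, (1 - t * b j)) *
    (∏ p ∈ Finset.univ.filter fun p : Fin l × Fin l => p.1 ≤ p.2,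
      ((1 - t * a p.1 * b p.2) * (1 - t * a p.1 * (b p.2)⁻¹))) *
    ∏ p ∈ Finset.univ.filter fun p : Fin l × Fin l => p.2 < p.1,
      ((1 - t * a p.1 * b p.2) * (1 - t * (a p.1)⁻¹ * b p.2))

/-- The factor `d_1(Ξ)` of Case A. -/
def d1A (l : ℕ) (a : Fin l → ℂ) : ℂ :=
  (∏ i : Fin l, (1 - a i ^ 2)) *
    ∏ p ∈ Finset.univ.filter fun p : Fin l × Fin l => p.1 < p.2,
      ((1 - a p.1 * a p.2) * (1 - a p.1 * (a p.2)⁻¹))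

/-- The factor `d_0(ξ)` of Case A. -/
def d0A (l : ℕ) (b : Fin l → ℂ) : ℂ :=
  (∏ i : Fin l, (1 - b i)) *
    ∏ p ∈ Finset.univ.filter fun p : Fin l × Fin l => p.1 < p.2,
      ((1 - b p.1 * b p.2) * (1 - b p.1 * (b p.2)⁻¹))

/-- `c(Ξ,ξ) = b(Ξ,ξ) / (d_1(Ξ) d_0(ξ))` of Case A. -/
def cA (l : ℕ) (t : ℂ) (a b : Fin l → ℂ) : ℂ :=
  bA l t a b / (d1A l a * d0A l b)

/-- The Weyl-group sum `A_{Ξ,ξ} = ∑_{w',w ∈ W_l} c(w'Ξ, wξ)` of Case A. -/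
def AA (l : ℕ) (t : ℂ) (a b : Fin l → ℂ) : ℂ :=
  ∑ w' : SignedPerm l, ∑ w : SignedPerm l, cA l t (sact w' a) (sact w b)

/-- GL-regularity: `a_i a_j ≠ 1` for `i ≤ j` and the `a_i` are pairwise distinct. -/
def GLRegular (l : ℕ) (a : Fin l → ℂ) : Prop :=
  (∀ i j : Fin l, i ≤ j → a i * a j ≠ 1) ∧ ∀ i j : Fin l, i ≠ j → a i ≠ a j

/-- B-regularity: `b_i ≠ 1`, `b_i b_j ≠ 1` for `i < j`, and the `b_i` are pairwise
distinct. -/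
def BRegular (l : ℕ) (b : Fin l → ℂ) : Prop :=
  (∀ i, b i ≠ 1) ∧ (∀ i j : Fin l, i < j → b i * b j ≠ 1) ∧
    ∀ i j : Fin l, i ≠ j → b i ≠ b j

/-- The Laurent monomial `u^λ v^μ` with exponent pair `e = (λ, μ)`, as a function of `(u, v)`. -/
def lmono {l : ℕ} (e : (Fin l → ℤ) × (Fin l → ℤ)) : (Fin l → ℂˣ) × (Fin l → ℂˣ) → ℂ :=
  fun x => (((∏ i, x.1 i ^ e.1 i) * ∏ j, x.2 j ^ e.2 j : ℂˣ) : ℂ)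

lemma lmono_zero {l : ℕ} : lmono (l := l) 0 = 1 := by
  funext x
  simp [lmono]

lemma lmono_add {l : ℕ} (e e' : (Fin l → ℤ) × (Fin l → ℤ)) :
    lmono (e + e') = lmono e * lmono e' := by
  funext x
  simp only [lmono, Prod.fst_add, Prod.snd_add, Pi.add_apply, zpow_add, Finset.prod_mul_distrib,
    Pi.mul_apply, ← Units.val_mul]
  congr 1
  exact mul_mul_mul_comm _ _ _ _

/-- Exponent pairs `(λ, μ)` with `|λ_i| ≤ d_i`, `2|λ_i| + |μ_j| ≤ c_{ij}` and `μ ≡ p mod 2`. -/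
def expSet {l : ℕ} (d : Fin l → ℤ) (c : Fin l → Fin l → ℤ) (p : Fin l → ℤ) :
    Set ((Fin l → ℤ) × (Fin l → ℤ)) :=
  {e | (∀ i, |e.1 i| ≤ d i) ∧ (∀ i j, 2 * |e.1 i| + |e.2 j| ≤ c i j) ∧ ∀ j, Even (e.2 j - p j)}

/-- Laurent polynomials all of whose exponents lie in `expSet d c p`. -/
def laurentLE {l : ℕ} (d : Fin l → ℤ) (c : Fin l → Fin l → ℤ) (p : Fin l → ℤ) :
    Submodule ℂ ((Fin l → ℂˣ) × (Fin l → ℂˣ) → ℂ) :=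
  Submodule.span ℂ (lmono '' expSet d c p)

lemma laurentLE_mono {l : ℕ} {d d' : Fin l → ℤ} {c c' : Fin l → Fin l → ℤ} {p p' : Fin l → ℤ}
    (hd : ∀ i, d i ≤ d' i) (hc : ∀ i j, c i j ≤ c' i j) (hp : ∀ j, p j = p' j) :
    laurentLE d c p ≤ laurentLE d' c' p' := by
  obtain rfl : p = p' := funext hp
  refine Submodule.span_mono (Set.image_mono ?_)
  rintro e ⟨h1, h2, h3⟩
  exact ⟨fun i => (h1 i).trans (hd i), fun i j => (h2 i j).trans (hc i j), h3⟩

lemma one_mem_laurentLE {l : ℕ} : (1 : (Fin l → ℂˣ) × (Fin l → ℂˣ) → ℂ) ∈ laurentLE 0 0 0 := by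
  refine Submodule.subset_span ⟨0, ?_, lmono_zero⟩
  simp [expSet]

lemma mul_mem_laurentLE {l : ℕ} {d d' : Fin l → ℤ} {c c' : Fin l → Fin l → ℤ} {p p' : Fin l → ℤ}
    {f g : (Fin l → ℂˣ) × (Fin l → ℂˣ) → ℂ} (hf : f ∈ laurentLE d c p)
    (hg : g ∈ laurentLE d' c' p') : f * g ∈ laurentLE (d + d') (c + c') (p + p') := by
  have h := Submodule.mul_mem_mul hf hg
  rw [laurentLE, laurentLE, Submodule.span_mul_span] at h
  refine Submodule.span_mono ?_ h
  rintro _ ⟨_, ⟨e, ⟨h1, h2, h3⟩, rfl⟩, _, ⟨e', ⟨h1', h2', h3'⟩, rfl⟩, rfl⟩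
  refine ⟨e + e', ⟨fun i => ?_, fun i j => ?_, fun j => ?_⟩, lmono_add e e'⟩
  · exact (abs_add_le _ _).trans (add_le_add (h1 i) (h1' i))
  · have := h2 i j
    have := h2' i j
    have := abs_add_le (e.1 i) (e'.1 i)
    have := abs_add_le (e.2 j) (e'.2 j)
    simp only [Prod.fst_add, Prod.snd_add, Pi.add_apply]
    linarith
  · have := (h3 j).add (h3' j)
    simp only [Prod.snd_add, Pi.add_apply]
    rwa [add_sub_add_comm]

lemma prod_mem_laurentLE {l : ℕ} {κ : Type*} (s : Finset κ) {d : κ → Fin l → ℤ}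
    {c : κ → Fin l → Fin l → ℤ} {p : κ → Fin l → ℤ}
    {f : κ → (Fin l → ℂˣ) × (Fin l → ℂˣ) → ℂ}
    (h : ∀ k ∈ s, f k ∈ laurentLE (d k) (c k) (p k)) :
    ∏ k ∈ s, f k ∈ laurentLE (∑ k ∈ s, d k) (∑ k ∈ s, c k) (∑ k ∈ s, p k) := by
  classical
  induction s using Finset.induction_on with
  | empty => simpa using one_mem_laurentLE
  | insert k s hk ih =>
    rw [Finset.prod_insert hk, Finset.sum_insert hk, Finset.sum_insert hk, Finset.sum_insert hk]
    exact mul_mem_laurentLE (h k (Finset.mem_insert_self k s))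
      (ih fun k' hk' => h k' (Finset.mem_insert_of_mem hk'))

lemma fst_zpow_mem_laurentLE {l : ℕ} {d : Fin l → ℤ} {c : Fin l → Fin l → ℤ} {p : Fin l → ℤ}
    (i : Fin l) (n : ℤ) (hd0 : ∀ i, 0 ≤ d i) (hd : |n| ≤ d i) (hc0 : ∀ i j, 0 ≤ c i j)
    (hc : ∀ j, 2 * |n| ≤ c i j) (hp : ∀ j, Even (p j)) :
    (fun x : (Fin l → ℂˣ) × (Fin l → ℂˣ) => (x.1 i : ℂ) ^ n) ∈ laurentLE d c p := by
  refine Submodule.subset_span ⟨(Pi.single i n, 0), ⟨fun k => ?_, fun k j => ?_, fun j => ?_⟩, ?_⟩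
  · by_cases h : k = i
    · subst h; simpa using hd
    · simpa [h] using hd0 k
  · by_cases h : k = i
    · subst h; simpa using hc j
    · simpa [h] using hc0 k j
  · simpa using hp j
  · funext x
    simp [lmono, Pi.single_apply, pow_ite, Finset.prod_ite_eq']

lemma snd_zpow_mem_laurentLE {l : ℕ} {d : Fin l → ℤ} {c : Fin l → Fin l → ℤ} {p : Fin l → ℤ}
    (j : Fin l) (n : ℤ) (hd0 : ∀ i, 0 ≤ d i) (hc0 : ∀ i j, 0 ≤ c i j)
    (hc : ∀ i, |n| ≤ c i j) (hp : ∀ k, k ≠ j → Even (p k)) (hpj : Even (n - p j)) :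
    (fun x : (Fin l → ℂˣ) × (Fin l → ℂˣ) => (x.2 j : ℂ) ^ n) ∈ laurentLE d c p := by
  refine Submodule.subset_span ⟨(0, Pi.single j n), ⟨fun k => ?_, fun i k => ?_, fun k => ?_⟩, ?_⟩
  · simpa using hd0 k
  · by_cases h : k = j
    · subst h; simpa using hc i
    · simpa [h] using hc0 i k
  · by_cases h : k = j
    · subst h; simpa using hpj
    · simpa [h] using hp k h
  · funext x
    simp [lmono, Pi.single_apply, pow_ite, Finset.prod_ite_eq']

/-- The action of signed permutations on tuples of units. -/
def sactUnits {l : ℕ} (w : SignedPerm l) (u : Fin l → ℂˣ) : Fin l → ℂˣ :=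
  fun k => if w.1 k then (u (w.2⁻¹ k))⁻¹ else u (w.2⁻¹ k)

/-- The sign character of the group of signed permutations. -/
def ssign {l : ℕ} (w : SignedPerm l) : ℂ :=
  ((Equiv.Perm.sign w.2 : ℤ) : ℂ) * ∏ k, if w.1 k then -1 else 1

lemma ssign_mul_self {l : ℕ} (w : SignedPerm l) : ssign w * ssign w = 1 := by
  have h1 : ((Equiv.Perm.sign w.2 : ℤ) : ℂ) * ((Equiv.Perm.sign w.2 : ℤ) : ℂ) = 1 := by
    rw [← Int.cast_mul, ← Units.val_mul, Int.units_mul_self]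
    simp
  have h2 : (∏ k, if w.1 k then (-1 : ℂ) else 1) * (∏ k, if w.1 k then (-1 : ℂ) else 1) = 1 := by
    rw [← Finset.prod_mul_distrib]
    exact Finset.prod_eq_one fun k _ => by split_ifs <;> norm_num
  rw [ssign, mul_mul_mul_comm, h1, h2, one_mul]

/-- The determinant `det (u_i^{n_j} - u_i^{-n_j})`. -/
def altDet {l : ℕ} (n : Fin l → ℤ) (u : Fin l → ℂˣ) : ℂ :=
  (Matrix.of fun i j => (u i : ℂ) ^ n j - (u i : ℂ) ^ (-n j)).det

lemma sum_ssign_mul_monomial {l : ℕ} (n : Fin l → ℤ) (u : Fin l → ℂˣ) :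
    ∑ w : SignedPerm l, ssign w * ∏ k, (sactUnits w u k : ℂ) ^ n k = altDet n u := by
  rw [altDet, Matrix.det_apply', Fintype.sum_prod_type, Finset.sum_comm,
    ← Equiv.sum_comp (Equiv.inv (Equiv.Perm (Fin l)))]
  refine Finset.sum_congr rfl fun σ _ => ?_
  have key : ∀ k, (u (σ k) : ℂ) ^ n k - (u (σ k) : ℂ) ^ (-n k) =
      ∑ s : Bool, (if s then -1 else 1) *
        (((if s then (u (σ k))⁻¹ else u (σ k) : ℂˣ) : ℂ) ^ n k) := by
    intro k
    simp [zpow_neg]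
    ring
  simp only [Matrix.of_apply, key, Finset.prod_univ_sum, Finset.mul_sum, Fintype.piFinset_univ]
  refine Finset.sum_congr rfl fun s _ => ?_
  simp only [ssign, sactUnits, Equiv.inv_apply, inv_inv, Equiv.Perm.sign_inv,
    Finset.prod_mul_distrib, mul_assoc]

lemma altDet_eq_zero_of_eq_zero {l : ℕ} {n : Fin l → ℤ} {j : Fin l} (h : n j = 0)
    (u : Fin l → ℂˣ) : altDet n u = 0 :=
  Matrix.det_eq_zero_of_column_eq_zero j fun i => by simp [h]

/-- If every `|n_j|` is a value of `r`, then `altDet n` is a constant multiple of `altDet r`,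
which vanishes unless the values can be matched bijectively. -/
lemma exists_altDet_eq {l : ℕ} {n r : Fin l → ℤ} (τ : Fin l → Fin l) (h : ∀ j, |n j| = r (τ j)) :
    ∃ K : ℂ, (¬ Function.Injective τ → K = 0) ∧ ∀ u, altDet n u = K * altDet r u := by
  have h1 : ∀ u, altDet n u =
      (∏ j, if 0 ≤ n j then (1 : ℂ) else -1) * altDet (fun j => r (τ j)) u := by
    intro u
    rw [altDet, altDet, ← Matrix.det_mul_row]
    congr 1
    ext i j
    simp only [Matrix.of_apply, ← h j]
    split_ifs with hj
    · rw [abs_of_nonneg hj, one_mul]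
    · rw [abs_of_neg (not_le.mp hj), neg_neg]
      ring
  by_cases hτ : Function.Injective τ
  · let σ := Equiv.ofBijective τ (Finite.injective_iff_bijective.mp hτ)
    refine ⟨(∏ j, if 0 ≤ n j then (1 : ℂ) else -1) * ((Equiv.Perm.sign σ : ℤ) : ℂ),
      fun h => absurd hτ h, fun u => ?_⟩
    rw [h1, mul_assoc, altDet, altDet, ← Matrix.det_permute']
    rfl
  · refine ⟨0, fun _ => rfl, fun u => ?_⟩
    obtain ⟨i, j, hij, hne⟩ : ∃ i j, τ i = τ j ∧ i ≠ j := by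
      simpa [Function.Injective] using hτ
    rw [h1, altDet, Matrix.det_zero_of_column_eq hne fun k => by simp [hij]]
    simp

/-- Antisymmetrization over both groups of signed permutations. -/
def alternate {l : ℕ} (f : (Fin l → ℂˣ) × (Fin l → ℂˣ) → ℂ) (x : (Fin l → ℂˣ) × (Fin l → ℂˣ)) :
    ℂ :=
  ∑ w' : SignedPerm l, ∑ w : SignedPerm l,
    ssign w' * ssign w * f (sactUnits w' x.1, sactUnits w x.2)

lemma alternate_lmono {l : ℕ} (e : (Fin l → ℤ) × (Fin l → ℤ))
    (x : (Fin l → ℂˣ) × (Fin l → ℂˣ)) :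
    alternate (lmono e) x = altDet e.1 x.1 * altDet e.2 x.2 := by
  rw [← sum_ssign_mul_monomial, ← sum_ssign_mul_monomial, Finset.sum_mul_sum]
  refine Finset.sum_congr rfl fun w' _ => Finset.sum_congr rfl fun w _ => ?_
  simp only [lmono, Units.val_mul, Units.coe_prod, Units.val_zpow_eq_zpow_val]
  ring

/-- The type C and type B Weyl vectors are the only dominant regular exponents available, so
antisymmetrization maps `laurentLE` to a line. -/
lemma exists_alternate_eq {l : ℕ} {f : (Fin l → ℂˣ) × (Fin l → ℂˣ) → ℂ}
    (hf : f ∈ laurentLE (fun _ => (l : ℤ)) (fun _ _ => 4 * l - 1) (fun _ => 1)) :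
    ∃ K : ℂ, ∀ x, alternate f x =
      K * (altDet (fun k => (k : ℤ) + 1) x.1 * altDet (fun k => 2 * (k : ℤ) + 1) x.2) := by
  induction hf using Submodule.span_induction with
  | mem f h =>
    obtain ⟨e, ⟨h1, h2, h3⟩, rfl⟩ := h
    by_cases h0 : ∃ j, e.1 j = 0
    · obtain ⟨j, hj⟩ := h0
      exact ⟨0, fun x => by rw [alternate_lmono, altDet_eq_zero_of_eq_zero hj]; simp⟩
    push Not at h0
    have hτ : ∀ j, ∃ k : Fin l, |e.1 j| = (k : ℤ) + 1 := fun j => by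
      have := abs_pos.mpr (h0 j)
      have : |e.1 j| ≤ l := h1 j
      exact ⟨⟨(|e.1 j| - 1).toNat, by omega⟩, by simp only; omega⟩
    choose τ hτ using hτ
    obtain ⟨K, hK0, hK⟩ := exists_altDet_eq (r := fun k => (k : ℤ) + 1) τ hτ
    by_cases hinj : Function.Injective τ
    · have hsurj := Finite.injective_iff_surjective.mp hinj
      have hν : ∀ j, ∃ k : Fin l, |e.2 j| = 2 * (k : ℤ) + 1 := fun j => by
        obtain ⟨i, hi⟩ := hsurj ⟨l - 1, by have := j.2; omega⟩
        have hi' := hτ i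
        rw [hi] at hi'
        have : 2 * |e.1 i| + |e.2 j| ≤ 4 * l - 1 := h2 i j
        obtain ⟨m, hm⟩ : Even (e.2 j - 1) := h3 j
        have := j.2
        simp only at hi'
        rcases abs_cases (e.2 j) with ⟨h, _⟩ | ⟨h, _⟩ <;>
        exact ⟨⟨((|e.2 j| - 1) / 2).toNat, by omega⟩, by simp only; omega⟩
      choose ν hν using hν
      obtain ⟨K', -, hK'⟩ := exists_altDet_eq (r := fun k => 2 * (k : ℤ) + 1) ν hν
      exact ⟨K * K', fun x => by rw [alternate_lmono, hK, hK']; ring⟩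
    · exact ⟨0, fun x => by rw [alternate_lmono, hK, hK0 hinj]; simp⟩
  | zero => exact ⟨0, fun x => by simp [alternate]⟩
  | add f g _ _ hf hg =>
    obtain ⟨K, hK⟩ := hf
    obtain ⟨K', hK'⟩ := hg
    refine ⟨K + K', fun x => ?_⟩
    rw [add_mul, ← hK, ← hK']
    simp only [alternate, Pi.add_apply, mul_add, Finset.sum_add_distrib]
  | smul z f _ hf =>
    obtain ⟨K, hK⟩ := hf
    refine ⟨z * K, fun x => ?_⟩
    rw [mul_assoc, ← hK]
    simp only [alternate, Pi.smul_apply, smul_eq_mul, Finset.mul_sum]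
    exact Finset.sum_congr rfl fun _ _ => Finset.sum_congr rfl fun _ _ => by ring

/-- The normalized Weyl denominator: type C for `m = 1`, type B in the variables `u²` for
`m = 2`. -/
def weylDenom {l : ℕ} (m : ℤ) (u : Fin l → ℂˣ) : ℂ :=
  (∏ i, ((u i : ℂ) ^ (-1 : ℤ) - (u i : ℂ) ^ (1 : ℤ))) *
    ∏ p ∈ Finset.univ.filter fun p : Fin l × Fin l => p.1 < p.2,
      ((u p.1 : ℂ) ^ m + (u p.1 : ℂ) ^ (-m) - ((u p.2 : ℂ) ^ m + (u p.2 : ℂ) ^ (-m)))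

lemma prod_filter_lt_sub_comp_perm {l : ℕ} (v : Fin l → ℂ) (σ : Equiv.Perm (Fin l)) :
    ∏ p ∈ Finset.univ.filter (fun p : Fin l × Fin l => p.1 < p.2), (v (σ p.1) - v (σ p.2)) =
      ((Equiv.Perm.sign σ : ℤ) : ℂ) *
        ∏ p ∈ Finset.univ.filter (fun p : Fin l × Fin l => p.1 < p.2), (v p.1 - v p.2) := by
  have h : ∀ v : Fin l → ℂ,
      ∏ p ∈ Finset.univ.filter (fun p : Fin l × Fin l => p.1 < p.2), (v p.1 - v p.2) =
        (Matrix.vandermonde fun i => -v i).det := by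
    intro v
    rw [Matrix.det_vandermonde, Finset.prod_filter, Fintype.prod_prod_type]
    refine Finset.prod_congr rfl fun i _ => ?_
    rw [← Finset.prod_filter, Finset.filter_lt_eq_Ioi]
    exact Finset.prod_congr rfl fun j _ => by ring
  rw [h v, h fun i => v (σ i), ← Matrix.det_permute]
  rfl

lemma weylDenom_sactUnits {l : ℕ} (m : ℤ) (w : SignedPerm l) (u : Fin l → ℂˣ) :
    weylDenom m (sactUnits w u) = ssign w * weylDenom m u := by
  have h1 : ∀ k, (sactUnits w u k : ℂ) ^ m + (sactUnits w u k : ℂ) ^ (-m) =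
      (u (w.2⁻¹ k) : ℂ) ^ m + (u (w.2⁻¹ k) : ℂ) ^ (-m) := by
    intro k
    simp only [sactUnits]
    split_ifs
    · simp [add_comm]
    · rfl
  have h2 : ∏ k, ((sactUnits w u k : ℂ) ^ (-1 : ℤ) - (sactUnits w u k : ℂ) ^ (1 : ℤ)) =
      (∏ k, if w.1 k then (-1 : ℂ) else 1) *
        ∏ k, ((u k : ℂ) ^ (-1 : ℤ) - (u k : ℂ) ^ (1 : ℤ)) := by
    rw [← Equiv.prod_comp w.2⁻¹ fun k => ((u k : ℂ) ^ (-1 : ℤ) - (u k : ℂ) ^ (1 : ℤ)),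
      ← Finset.prod_mul_distrib]
    refine Finset.prod_congr rfl fun k _ => ?_
    simp only [sactUnits]
    split_ifs <;> simp
  simp only [weylDenom, h1, h2]
  rw [prod_filter_lt_sub_comp_perm (fun k => (u k : ℂ) ^ m + (u k : ℂ) ^ (-m)) w.2⁻¹,
    Equiv.Perm.sign_inv, ssign]
  ring

/-- The product of the two normalized Weyl denominators. -/
def weylDenomPair {l : ℕ} (x : (Fin l → ℂˣ) × (Fin l → ℂˣ)) : ℂ :=
  weylDenom 1 x.1 * weylDenom 2 x.2

lemma alternate_weylDenomPair {l : ℕ} (x : (Fin l → ℂˣ) × (Fin l → ℂˣ)) :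
    alternate weylDenomPair x = (Fintype.card (SignedPerm l) : ℂ) ^ 2 * weylDenomPair x := by
  have h : ∀ w' w : SignedPerm l,
      ssign w' * ssign w * weylDenomPair (sactUnits w' x.1, sactUnits w x.2) =
        weylDenomPair x := by
    intro w' w
    simp only [weylDenomPair, weylDenom_sactUnits]
    linear_combination (weylDenom 1 x.1 * weylDenom 2 x.2 * ssign w * ssign w) * ssign_mul_self w'
      + (weylDenom 1 x.1 * weylDenom 2 x.2) * ssign_mul_self w
  simp only [alternate, h, Finset.sum_const, Finset.card_univ, nsmul_eq_mul]
  ring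

/-- The numerator of Case A in the variables `(u, v²)`, normalized to be a balanced Laurent
polynomial. -/
def numer {l : ℕ} (t : ℂ) (x : (Fin l → ℂˣ) × (Fin l → ℂˣ)) : ℂ :=
  (∏ j, ((x.2 j : ℂ) ^ (-1 : ℤ) - t * (x.2 j : ℂ) ^ (1 : ℤ))) *
    ∏ p : Fin l × Fin l, if p.1 ≤ p.2
      then (x.1 p.1 : ℂ) ^ (-1 : ℤ) + t ^ 2 * (x.1 p.1 : ℂ) ^ (1 : ℤ)
        - t * ((x.2 p.2 : ℂ) ^ (2 : ℤ) + (x.2 p.2 : ℂ) ^ (-2 : ℤ))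
      else (x.2 p.2 : ℂ) ^ (-2 : ℤ) + t ^ 2 * (x.2 p.2 : ℂ) ^ (2 : ℤ)
        - t * ((x.1 p.1 : ℂ) ^ (1 : ℤ) + (x.1 p.1 : ℂ) ^ (-1 : ℤ))

lemma sum_filter_lt_ite {l : ℕ} (i : Fin l) :
    ∑ p ∈ Finset.univ.filter (fun p : Fin l × Fin l => p.1 < p.2),
      ((if i = p.1 then 1 else 0) + (if i = p.2 then 1 else 0) : ℤ) = l - 1 := by
  rw [Finset.sum_add_distrib, Finset.sum_filter, Finset.sum_filter, Fintype.sum_prod_type,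
    Fintype.sum_prod_type_right]
  have h1 : ∀ a b : Fin l, (if a < b then if i = a then (1 : ℤ) else 0 else 0) =
      if i = a then if i < b then 1 else 0 else 0 := by
    intro a b
    by_cases h : i = a <;> simp [h]
  have h2 : ∀ a b : Fin l, (if a < b then if i = b then (1 : ℤ) else 0 else 0) =
      if i = b then if a < i then 1 else 0 else 0 := by
    intro a b
    by_cases h : i = b <;> simp [h]
  simp only [h1, h2]
  have h3 : ∑ b : Fin l, (if i < b then (1 : ℤ) else 0) = l - 1 - i := by
    rw [← Finset.sum_filter, Finset.filter_lt_eq_Ioi, Finset.sum_const, Fin.card_Ioi]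
    have := i.2
    simp only [nsmul_eq_mul, mul_one]
    omega
  have h4 : ∑ a : Fin l, (if a < i then (1 : ℤ) else 0) = i := by
    rw [← Finset.sum_filter, Finset.filter_gt_eq_Iio, Finset.sum_const, Fin.card_Iio]
    simp
  have h5 : ∀ g : Fin l → ℤ, ∑ a : Fin l, ∑ b : Fin l, (if i = a then g b else 0) = ∑ b, g b := by
    intro g
    rw [Finset.sum_comm]
    simp
  rw [h5, h5, h3, h4]
  ring

lemma sum_ite_fst {l : ℕ} (i : Fin l) (k : ℤ) :
    ∑ p : Fin l × Fin l, (if i = p.1 then k else 0) = l * k := by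
  rw [Fintype.sum_prod_type, Finset.sum_comm]
  simp

lemma numer_mem {l : ℕ} (t : ℂ) : numer (l := l) t ∈
    laurentLE (fun _ => (l : ℤ)) (fun _ _ => 4 * l - 1) (fun _ => 1) := by
  have h1 : ∀ j ∈ (Finset.univ : Finset (Fin l)),
      (fun x : (Fin l → ℂˣ) × (Fin l → ℂˣ) =>
        (x.2 j : ℂ) ^ (-1 : ℤ) - t * (x.2 j : ℂ) ^ (1 : ℤ)) ∈
      laurentLE 0 (fun _ k => if k = j then 1 else 0) (fun k => if k = j then 1 else 0) := by
    intro j _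
    refine sub_mem ?_ (Submodule.smul_mem _ t ?_) <;>
    refine snd_zpow_mem_laurentLE j _ ?_ ?_ ?_ ?_ ?_ <;> intros <;> simp_all <;> grind
  have h2 : ∀ p ∈ (Finset.univ : Finset (Fin l × Fin l)),
      (fun x : (Fin l → ℂˣ) × (Fin l → ℂˣ) => if p.1 ≤ p.2
      then (x.1 p.1 : ℂ) ^ (-1 : ℤ) + t ^ 2 * (x.1 p.1 : ℂ) ^ (1 : ℤ)
        - t * ((x.2 p.2 : ℂ) ^ (2 : ℤ) + (x.2 p.2 : ℂ) ^ (-2 : ℤ))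
      else (x.2 p.2 : ℂ) ^ (-2 : ℤ) + t ^ 2 * (x.2 p.2 : ℂ) ^ (2 : ℤ)
        - t * ((x.1 p.1 : ℂ) ^ (1 : ℤ) + (x.1 p.1 : ℂ) ^ (-1 : ℤ))) ∈
      laurentLE (fun i => if i = p.1 then 1 else 0)
        (fun i j => (if i = p.1 then 2 else 0) + (if j = p.2 then 2 else 0)
          - if i = p.1 then if j = p.2 then 2 else 0 else 0) 0 := by
    intro p _
    have hu : ∀ n : ℤ, |n| = 1 → (fun x : (Fin l → ℂˣ) × (Fin l → ℂˣ) => (x.1 p.1 : ℂ) ^ n) ∈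
      laurentLE (fun i => if i = p.1 then 1 else 0)
        (fun i j => (if i = p.1 then 2 else 0) + (if j = p.2 then 2 else 0)
          - if i = p.1 then if j = p.2 then 2 else 0 else 0) 0 := by
      intro n hn
      refine fst_zpow_mem_laurentLE p.1 n ?_ ?_ ?_ ?_ ?_ <;> intros <;> simp -failIfUnchanged [hn] <;> grind
    have hv : ∀ n : ℤ, |n| = 2 → (fun x : (Fin l → ℂˣ) × (Fin l → ℂˣ) => (x.2 p.2 : ℂ) ^ n) ∈
      laurentLE (fun i => if i = p.1 then 1 else 0)
        (fun i j => (if i = p.1 then 2 else 0) + (if j = p.2 then 2 else 0)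
          - if i = p.1 then if j = p.2 then 2 else 0 else 0) 0 := by
      intro n hn
      have : Even n := by rcases (abs_eq (by norm_num)).mp hn with rfl | rfl <;> decide
      refine snd_zpow_mem_laurentLE p.2 n ?_ ?_ ?_ ?_ ?_ <;> intros <;> simp -failIfUnchanged [hn, this] <;> grind
    by_cases h : p.1 ≤ p.2
    · simp only [h, if_true]
      exact sub_mem (add_mem (hu _ rfl) (Submodule.smul_mem _ (t ^ 2) (hu _ rfl)))
        (Submodule.smul_mem _ t (add_mem (hv _ rfl) (hv _ rfl)))
    · simp only [h, if_false]
      exact sub_mem (add_mem (hv _ rfl) (Submodule.smul_mem _ (t ^ 2) (hv _ rfl)))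
        (Submodule.smul_mem _ t (add_mem (hu _ rfl) (hu _ rfl)))
  have h := mul_mem_laurentLE (prod_mem_laurentLE _ h1) (prod_mem_laurentLE _ h2)
  have heq : numer (l := l) t = (∏ j, fun x : (Fin l → ℂˣ) × (Fin l → ℂˣ) =>
        (x.2 j : ℂ) ^ (-1 : ℤ) - t * (x.2 j : ℂ) ^ (1 : ℤ)) *
      ∏ p : Fin l × Fin l, fun x : (Fin l → ℂˣ) × (Fin l → ℂˣ) => if p.1 ≤ p.2
      then (x.1 p.1 : ℂ) ^ (-1 : ℤ) + t ^ 2 * (x.1 p.1 : ℂ) ^ (1 : ℤ)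
        - t * ((x.2 p.2 : ℂ) ^ (2 : ℤ) + (x.2 p.2 : ℂ) ^ (-2 : ℤ))
      else (x.2 p.2 : ℂ) ^ (-2 : ℤ) + t ^ 2 * (x.2 p.2 : ℂ) ^ (2 : ℤ)
        - t * ((x.1 p.1 : ℂ) ^ (1 : ℤ) + (x.1 p.1 : ℂ) ^ (-1 : ℤ)) := by
    funext x
    simp only [numer, Pi.mul_apply, Finset.prod_apply]
  rw [heq]
  refine laurentLE_mono ?_ ?_ ?_ h
  · intro i
    simp only [Pi.add_apply, Finset.sum_apply, sum_ite_fst]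
    simp
  · intro i j
    simp only [Pi.add_apply, Finset.sum_apply, Finset.sum_add_distrib, Finset.sum_sub_distrib,
      sum_ite_fst]
    simp [Fintype.sum_prod_type]
    linarith
  · intro j
    simp [Finset.sum_apply]

lemma weylDenomPair_mem {l : ℕ} : weylDenomPair (l := l) ∈
    laurentLE (fun _ => (l : ℤ)) (fun _ _ => 4 * l - 1) (fun _ => 1) := by
  have h1 : ∀ i ∈ (Finset.univ : Finset (Fin l)),
      (fun x : (Fin l → ℂˣ) × (Fin l → ℂˣ) =>
        (x.1 i : ℂ) ^ (-1 : ℤ) - (x.1 i : ℂ) ^ (1 : ℤ)) ∈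
      laurentLE (fun k => if k = i then 1 else 0) (fun k _ => 2 * if k = i then 1 else 0) 0 := by
    intro i _
    refine sub_mem ?_ ?_ <;>
    refine fst_zpow_mem_laurentLE i _ ?_ ?_ ?_ ?_ ?_ <;> intros <;> simp -failIfUnchanged <;> grind
  have h2 : ∀ p ∈ Finset.univ.filter (fun p : Fin l × Fin l => p.1 < p.2),
      (fun x : (Fin l → ℂˣ) × (Fin l → ℂˣ) =>
        (x.1 p.1 : ℂ) ^ (1 : ℤ) + (x.1 p.1 : ℂ) ^ (-1 : ℤ)
          - ((x.1 p.2 : ℂ) ^ (1 : ℤ) + (x.1 p.2 : ℂ) ^ (-1 : ℤ))) ∈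
      laurentLE (fun k => (if k = p.1 then 1 else 0) + if k = p.2 then 1 else 0)
        (fun k _ => 2 * ((if k = p.1 then 1 else 0) + if k = p.2 then 1 else 0)) 0 := by
    intro p _
    refine sub_mem (add_mem ?_ ?_) (add_mem ?_ ?_) <;>
    refine fst_zpow_mem_laurentLE _ _ ?_ ?_ ?_ ?_ ?_ <;> intros <;> simp -failIfUnchanged <;> grind
  have h3 : ∀ j ∈ (Finset.univ : Finset (Fin l)),
      (fun x : (Fin l → ℂˣ) × (Fin l → ℂˣ) =>
        (x.2 j : ℂ) ^ (-1 : ℤ) - (x.2 j : ℂ) ^ (1 : ℤ)) ∈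
      laurentLE 0 (fun _ k => if k = j then 1 else 0) (fun k => if k = j then 1 else 0) := by
    intro j _
    refine sub_mem ?_ ?_ <;>
    refine snd_zpow_mem_laurentLE j _ ?_ ?_ ?_ ?_ ?_ <;> intros <;> simp_all <;> grind
  have h4 : ∀ p ∈ Finset.univ.filter (fun p : Fin l × Fin l => p.1 < p.2),
      (fun x : (Fin l → ℂˣ) × (Fin l → ℂˣ) =>
        (x.2 p.1 : ℂ) ^ (2 : ℤ) + (x.2 p.1 : ℂ) ^ (-2 : ℤ)
          - ((x.2 p.2 : ℂ) ^ (2 : ℤ) + (x.2 p.2 : ℂ) ^ (-2 : ℤ))) ∈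
      laurentLE 0 (fun _ k => 2 * ((if k = p.1 then 1 else 0) + if k = p.2 then 1 else 0)) 0 := by
    intro p _
    refine sub_mem (add_mem ?_ ?_) (add_mem ?_ ?_) <;>
    refine snd_zpow_mem_laurentLE _ _ ?_ ?_ ?_ ?_ ?_ <;> intros <;> simp -failIfUnchanged <;> grind
  have h := mul_mem_laurentLE
    (mul_mem_laurentLE (prod_mem_laurentLE _ h1) (prod_mem_laurentLE _ h2))
    (mul_mem_laurentLE (prod_mem_laurentLE _ h3) (prod_mem_laurentLE _ h4))
  have heq : ∀ {g : (Fin l → ℂˣ) × (Fin l → ℂˣ) → ℂ}, (∀ x, g x = weylDenomPair x) →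
      g ∈ laurentLE (fun _ => (l : ℤ)) (fun _ _ => 4 * l - 1) (fun _ => 1) →
      weylDenomPair (l := l) ∈
        laurentLE (fun _ => (l : ℤ)) (fun _ _ => 4 * l - 1) (fun _ => 1) := by
    intro g hg hm
    rwa [← funext hg]
  refine heq ?_ (laurentLE_mono ?_ ?_ ?_ h)
  · intro x
    simp only [weylDenomPair, weylDenom, Pi.mul_apply, Finset.prod_apply]
  · intro i
    simp only [Pi.add_apply, Finset.sum_apply, sum_filter_lt_ite]
    simp
  · intro i j
    simp only [Pi.add_apply, Finset.sum_apply, ← Finset.mul_sum, sum_filter_lt_ite]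
    simp
    linarith
  · intro j
    simp [Finset.sum_apply]

lemma d1A_eq {l : ℕ} (u : Fin l → ℂˣ) :
    d1A l (fun i => u i) = ((∏ i, (u i : ℂ)) *
      ∏ p ∈ Finset.univ.filter (fun p : Fin l × Fin l => p.1 < p.2), (u p.1 : ℂ)) *
        weylDenom 1 u := by
  rw [d1A, weylDenom, mul_mul_mul_comm, ← Finset.prod_mul_distrib, ← Finset.prod_mul_distrib]
  congr 1 <;> refine Finset.prod_congr rfl fun p _ => ?_
  · have := (u p).ne_zero
    simp only [zpow_neg, zpow_one]
    field_simp
  · have := (u p.1).ne_zero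
    have := (u p.2).ne_zero
    simp only [zpow_neg, zpow_one]
    field_simp
    ring

lemma d0A_eq {l : ℕ} (v : Fin l → ℂˣ) :
    d0A l (fun i => (v i : ℂ) ^ 2) = ((∏ i, (v i : ℂ)) *
      ∏ p ∈ Finset.univ.filter (fun p : Fin l × Fin l => p.1 < p.2), (v p.1 : ℂ) ^ 2) *
        weylDenom 2 v := by
  rw [d0A, weylDenom, mul_mul_mul_comm, ← Finset.prod_mul_distrib, ← Finset.prod_mul_distrib]
  congr 1 <;> refine Finset.prod_congr rfl fun p _ => ?_
  · have := (v p).ne_zero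
    simp only [zpow_neg, zpow_one]
    field_simp
  · have := (v p.1).ne_zero
    have := (v p.2).ne_zero
    simp only [zpow_neg, zpow_ofNat]
    field_simp
    ring

lemma prod_filter_le_fst {l : ℕ} (f : Fin l → ℂ) :
    ∏ p ∈ Finset.univ.filter (fun p : Fin l × Fin l => p.1 ≤ p.2), f p.1 =
      (∏ i, f i) * ∏ p ∈ Finset.univ.filter (fun p : Fin l × Fin l => p.1 < p.2), f p.1 := by
  rw [Finset.prod_filter, Finset.prod_filter, Fintype.prod_prod_type, Fintype.prod_prod_type,
    ← Finset.prod_mul_distrib]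
  refine Finset.prod_congr rfl fun i _ => ?_
  have h : f i = ∏ j, if i = j then f i else 1 := by simp
  conv_rhs => rw [h, ← Finset.prod_mul_distrib]
  refine Finset.prod_congr rfl fun j _ => ?_
  rcases lt_trichotomy i j with hij | rfl | hij
  · simp [hij, hij.le, hij.ne]
  · simp
  · simp [hij.not_ge, hij.not_gt, hij.ne']

lemma prod_filter_gt_snd {l : ℕ} (f : Fin l → ℂ) :
    ∏ p ∈ Finset.univ.filter (fun p : Fin l × Fin l => p.2 < p.1), f p.2 =
      ∏ p ∈ Finset.univ.filter (fun p : Fin l × Fin l => p.1 < p.2), f p.1 := by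
  rw [Finset.prod_filter, Finset.prod_filter, Fintype.prod_prod_type,
    Fintype.prod_prod_type_right]

lemma bA_eq {l : ℕ} (t : ℂ) (u v : Fin l → ℂˣ) :
    bA l t (fun i => u i) (fun i => (v i : ℂ) ^ 2) =
      (((∏ i, (u i : ℂ)) *
        ∏ p ∈ Finset.univ.filter (fun p : Fin l × Fin l => p.1 < p.2), (u p.1 : ℂ)) *
      ((∏ i, (v i : ℂ)) *
        ∏ p ∈ Finset.univ.filter (fun p : Fin l × Fin l => p.1 < p.2), (v p.1 : ℂ) ^ 2)) *
        numer t (u, v) := by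
  have hfilter : (Finset.univ.filter fun p : Fin l × Fin l => ¬ p.1 ≤ p.2) =
      Finset.univ.filter fun p : Fin l × Fin l => p.2 < p.1 := by simp only [not_le]
  rw [← prod_filter_le_fst fun i => (u i : ℂ), ← prod_filter_gt_snd fun i => (v i : ℂ) ^ 2, bA,
    numer, Finset.prod_ite, hfilter]
  have h1 : ∏ j, (1 - t * (v j : ℂ) ^ 2) = (∏ j, (v j : ℂ)) *
      ∏ j, ((v j : ℂ) ^ (-1 : ℤ) - t * (v j : ℂ) ^ (1 : ℤ)) := by
    rw [← Finset.prod_mul_distrib]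
    refine Finset.prod_congr rfl fun j _ => ?_
    have := (v j).ne_zero
    simp only [zpow_neg, zpow_one]
    field_simp
  have h2 : ∏ p ∈ Finset.univ.filter (fun p : Fin l × Fin l => p.1 ≤ p.2),
      ((1 - t * (u p.1 : ℂ) * (v p.2 : ℂ) ^ 2) * (1 - t * (u p.1 : ℂ) * ((v p.2 : ℂ) ^ 2)⁻¹)) =
      (∏ p ∈ Finset.univ.filter (fun p : Fin l × Fin l => p.1 ≤ p.2), (u p.1 : ℂ)) *
      ∏ p ∈ Finset.univ.filter (fun p : Fin l × Fin l => p.1 ≤ p.2),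
        ((u p.1 : ℂ) ^ (-1 : ℤ) + t ^ 2 * (u p.1 : ℂ) ^ (1 : ℤ)
          - t * ((v p.2 : ℂ) ^ (2 : ℤ) + (v p.2 : ℂ) ^ (-2 : ℤ))) := by
    rw [← Finset.prod_mul_distrib]
    refine Finset.prod_congr rfl fun p _ => ?_
    have := (u p.1).ne_zero
    have := (v p.2).ne_zero
    simp only [zpow_neg, zpow_ofNat]
    field_simp
    ring
  have h3 : ∏ p ∈ Finset.univ.filter (fun p : Fin l × Fin l => p.2 < p.1),
      ((1 - t * (u p.1 : ℂ) * (v p.2 : ℂ) ^ 2) * (1 - t * (u p.1 : ℂ)⁻¹ * (v p.2 : ℂ) ^ 2)) =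
      (∏ p ∈ Finset.univ.filter (fun p : Fin l × Fin l => p.2 < p.1), (v p.2 : ℂ) ^ 2) *
      ∏ p ∈ Finset.univ.filter (fun p : Fin l × Fin l => p.2 < p.1),
        ((v p.2 : ℂ) ^ (-2 : ℤ) + t ^ 2 * (v p.2 : ℂ) ^ (2 : ℤ)
          - t * ((u p.1 : ℂ) ^ (1 : ℤ) + (u p.1 : ℂ) ^ (-1 : ℤ))) := by
    rw [← Finset.prod_mul_distrib]
    refine Finset.prod_congr rfl fun p _ => ?_
    have := (u p.1).ne_zero
    have := (v p.2).ne_zero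
    simp only [zpow_neg, zpow_ofNat]
    field_simp
    ring
  rw [h1, h2, h3]
  ring

lemma cA_eq {l : ℕ} (t : ℂ) (u v : Fin l → ℂˣ) :
    cA l t (fun i => u i) (fun i => (v i : ℂ) ^ 2) = numer t (u, v) / weylDenomPair (u, v) := by
  rw [cA, bA_eq, d1A_eq, d0A_eq, mul_mul_mul_comm _ (weylDenom 1 u), weylDenomPair]
  refine mul_div_mul_left _ _ ?_
  simp [Finset.prod_eq_zero_iff]

lemma sact_units {l : ℕ} (w : SignedPerm l) (u : Fin l → ℂˣ) :
    sact w (fun i => (u i : ℂ)) = fun i => (sactUnits w u i : ℂ) := by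
  funext k
  simp only [sact, sactUnits]
  split_ifs <;> simp

lemma sact_units_sq {l : ℕ} (w : SignedPerm l) (v : Fin l → ℂˣ) :
    sact w (fun i => (v i : ℂ) ^ 2) = fun i => (sactUnits w v i : ℂ) ^ 2 := by
  funext k
  simp only [sact, sactUnits]
  split_ifs <;> simp

lemma AA_eq {l : ℕ} (t : ℂ) (u v : Fin l → ℂˣ) :
    AA l t (fun i => u i) (fun i => (v i : ℂ) ^ 2) =
      alternate (numer t) (u, v) / weylDenomPair (u, v) := by
  simp only [AA, alternate, Finset.sum_div]
  refine Finset.sum_congr rfl fun w' _ => Finset.sum_congr rfl fun w _ => ?_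
  rw [sact_units, sact_units_sq, cA_eq]
  simp only [weylDenomPair, weylDenom_sactUnits]
  have h : ∀ w : SignedPerm l, (ssign w)⁻¹ = ssign w := fun w =>
    inv_eq_of_mul_eq_one_left (ssign_mul_self w)
  simp only [div_eq_mul_inv, mul_inv, h]
  ring

lemma d1A_ne_zero {l : ℕ} {a : Fin l → ℂ} (ha0 : ∀ i, a i ≠ 0) (ha : GLRegular l a) :
    d1A l a ≠ 0 := by
  refine mul_ne_zero (Finset.prod_ne_zero_iff.mpr fun i _ => ?_)
    (Finset.prod_ne_zero_iff.mpr fun p hp => ?_)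
  · rw [sq]
    exact sub_ne_zero.mpr (ha.1 i i le_rfl).symm
  · have hp : p.1 < p.2 := by simpa using hp
    refine mul_ne_zero (sub_ne_zero.mpr (ha.1 _ _ hp.le).symm) (sub_ne_zero.mpr fun h => ?_)
    exact ha.2 _ _ hp.ne ((mul_inv_eq_one₀ (ha0 _)).mp h.symm)

lemma d0A_ne_zero {l : ℕ} {b : Fin l → ℂ} (hb0 : ∀ i, b i ≠ 0) (hb : BRegular l b) :
    d0A l b ≠ 0 := by
  refine mul_ne_zero (Finset.prod_ne_zero_iff.mpr fun i _ => sub_ne_zero.mpr (hb.1 i).symm)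
    (Finset.prod_ne_zero_iff.mpr fun p hp => ?_)
  have hp : p.1 < p.2 := by simpa using hp
  refine mul_ne_zero (sub_ne_zero.mpr (hb.2.1 _ _ hp).symm) (sub_ne_zero.mpr fun h => ?_)
  exact hb.2.2 _ _ hp.ne ((mul_inv_eq_one₀ (hb0 _)).mp h.symm)

lemma exists_AA_eq (l : ℕ) (t : ℂ) : ∃ C : ℂ, ∀ a b : Fin l → ℂ, (∀ i, a i ≠ 0) →
    (∀ i, b i ≠ 0) → GLRegular l a → BRegular l b → AA l t a b = C := by
  obtain ⟨K, hK⟩ := exists_alternate_eq (numer_mem (l := l) t)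
  obtain ⟨K', hK'⟩ := exists_alternate_eq (weylDenomPair_mem (l := l))
  refine ⟨K / K' * (Fintype.card (SignedPerm l) : ℂ) ^ 2, fun a b ha0 hb0 ha hb => ?_⟩
  obtain ⟨u, rfl⟩ : ∃ u : Fin l → ℂˣ, a = fun i => (u i : ℂ) :=
    ⟨fun i => Units.mk0 (a i) (ha0 i), rfl⟩
  obtain ⟨v, rfl⟩ : ∃ v : Fin l → ℂˣ, b = fun i => (v i : ℂ) ^ 2 := by
    choose r hr using fun i => IsSquare.exists_sq (b i) (IsAlgClosed.exists_eq_mul_self (b i))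
    exact ⟨fun i => Units.mk0 (r i) fun h => hb0 i (by simp [hr, h]), funext hr⟩
  have hD : weylDenomPair (u, v) ≠ 0 := by
    have h1 := d1A_ne_zero ha0 ha
    have h0 := d0A_ne_zero hb0 hb
    rw [d1A_eq] at h1
    rw [d0A_eq] at h0
    exact mul_ne_zero (right_ne_zero_of_mul h1) (right_ne_zero_of_mul h0)
  have hW : (Fintype.card (SignedPerm l) : ℂ) ^ 2 ≠ 0 :=
    pow_ne_zero _ (Nat.cast_ne_zero.mpr Fintype.card_ne_zero)
  have h := hK' (u, v)
  rw [alternate_weylDenomPair] at h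
  have hK'0 : K' ≠ 0 := left_ne_zero_of_mul (h ▸ mul_ne_zero hW hD)
  rw [AA_eq, hK, div_eq_iff hD, mul_assoc, h]
  field_simp

/-- Case A of the paper's Lemma: the Weyl-group sum `A_{Ξ,ξ}` is independent of the
regular pair `(Ξ, ξ)`. -/
theorem stmt4 (l : ℕ) (hl : 1 ≤ l) (q : ℝ) (hq : 1 < q) (t : ℂ)
    (ht : t = ((Real.sqrt q)⁻¹ : ℝ))
    (a b a' b' : Fin l → ℂ)
    (ha0 : ∀ i, a i ≠ 0) (hb0 : ∀ i, b i ≠ 0) (ha'0 : ∀ i, a' i ≠ 0) (hb'0 : ∀ i, b' i ≠ 0)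
    (ha : GLRegular l a) (ha' : GLRegular l a') (hb : BRegular l b) (hb' : BRegular l b') :
    AA l t a b = AA l t a' b' := by
  obtain ⟨C, hC⟩ := exists_AA_eq l t
  rw [hC a b ha0 hb0 ha hb, hC a' b' ha'0 hb'0 ha' hb']

end GrossPrasadCaseA
end
end

section
/- Fix an integer m ≥ 1 and a real number q > 1, and set t := q^{−1/2}. If (a, b) and (a′, b′) are two pairs consisting of a B-regular (m+1)-tuple and a C-regular m-tuple of nonzero complex numbers, then A_B(t; a, b) = A_B(t; a′, b′). In other words, the Weyl-group sum A_B(t; a, b) is independent of the regular pair (a, b). -/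
noncomputable section

namespace GrossPrasadCaseB

/-- The group `W_n = (ℤ/2)^n ⋊ S_n` of signed permutations, encoded as a pair of a sign
vector and a permutation. -/
abbrev SignedPerm (n : ℕ) := (Fin n → Bool) × Equiv.Perm (Fin n)

/-- The action of a signed permutation on an `n`-tuple: permute and invert marked
coordinates, `((ε,σ)·a)_k = a_{σ⁻¹ k}^{ε_k}`. -/
def sact {n : ℕ} (w : SignedPerm n) (a : Fin n → ℂ) : Fin n → ℂ :=
  fun k => if w.1 k then (a (w.2⁻¹ k))⁻¹ else a (w.2⁻¹ k)

/-- The numerator product `b(Ξ,ξ)` of Case B, for an `(m+1)`-tuple `a` and an `m`-tuple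
`b`:  `∏_{i=1}^{m+1}(1-ta_i) ∏_{1≤i≤j≤m}(1-ta_ib_j)(1-ta_ib_j⁻¹)
∏_{1≤j<i≤m+1}(1-ta_ib_j)(1-ta_i⁻¹b_j)`. -/
def bB (m : ℕ) (t : ℂ) (a : Fin (m + 1) → ℂ) (b : Fin m → ℂ) : ℂ :=
  (∏ i : Fin (m + 1), (1 - t * a i)) *
    (∏ p ∈ Finset.univ.filter fun p : Fin m × Fin m => p.1 ≤ p.2,
      ((1 - t * a p.1.castSucc * b p.2) * (1 - t * a p.1.castSucc * (b p.2)⁻¹))) *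
    ∏ p ∈ Finset.univ.filter fun p : Fin (m + 1) × Fin m => (p.2 : ℕ) < (p.1 : ℕ),
      ((1 - t * a p.1 * b p.2) * (1 - t * (a p.1)⁻¹ * b p.2))

/-- The factor `d_1(Ξ)` of Case B. -/
def d1B (m : ℕ) (a : Fin (m + 1) → ℂ) : ℂ :=
  (∏ i : Fin (m + 1), (1 - a i)) *
    ∏ p ∈ Finset.univ.filter fun p : Fin (m + 1) × Fin (m + 1) => p.1 < p.2,
      ((1 - a p.1 * a p.2) * (1 - a p.1 * (a p.2)⁻¹))

/-- The factor `d_0(ξ)` of Case B. -/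
def d0B (m : ℕ) (b : Fin m → ℂ) : ℂ :=
  (∏ i : Fin m, (1 - b i ^ 2)) *
    ∏ p ∈ Finset.univ.filter fun p : Fin m × Fin m => p.1 < p.2,
      ((1 - b p.1 * b p.2) * (1 - b p.1 * (b p.2)⁻¹))

/-- `c(Ξ,ξ) = b(Ξ,ξ) / (d_1(Ξ) d_0(ξ))` of Case B. -/
def cB (m : ℕ) (t : ℂ) (a : Fin (m + 1) → ℂ) (b : Fin m → ℂ) : ℂ :=
  bB m t a b / (d1B m a * d0B m b)

/-- The Weyl-group sum `A_{Ξ,ξ} = ∑_{w' ∈ W_{m+1}, w ∈ W_m} c(w'Ξ, wξ)` of Case B. -/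
def AB (m : ℕ) (t : ℂ) (a : Fin (m + 1) → ℂ) (b : Fin m → ℂ) : ℂ :=
  ∑ w' : SignedPerm (m + 1), ∑ w : SignedPerm m, cB m t (sact w' a) (sact w b)

/-- B-regularity: `a_i ≠ 1`, `a_i a_j ≠ 1` for `i < j`, and the `a_i` are pairwise
distinct. -/
def BRegular (n : ℕ) (a : Fin n → ℂ) : Prop :=
  (∀ i, a i ≠ 1) ∧ (∀ i j : Fin n, i < j → a i * a j ≠ 1) ∧
    ∀ i j : Fin n, i ≠ j → a i ≠ a j

/-- C-regularity: `b_i b_j ≠ 1` for `i ≤ j` and the `b_i` are pairwise distinct. -/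
def CRegular (n : ℕ) (b : Fin n → ℂ) : Prop :=
  (∀ i j : Fin n, i ≤ j → b i * b j ≠ 1) ∧ ∀ i j : Fin n, i ≠ j → b i ≠ b j

open Polynomial

theorem prod_lt_sub_eq {n : ℕ} (x : Fin n → ℂ) :
    ∏ p ∈ Finset.univ.filter fun p : Fin n × Fin n => p.1 < p.2, (x p.1 - x p.2) =
      (∏ _p ∈ Finset.univ.filter fun p : Fin n × Fin n => p.1 < p.2, (-1 : ℂ)) *
        (Matrix.vandermonde x).det := by
  have h : (Matrix.vandermonde x).det =
      ∏ p ∈ Finset.univ.filter fun p : Fin n × Fin n => p.1 < p.2, (x p.2 - x p.1) := by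
    rw [Matrix.det_vandermonde, Finset.prod_filter, Fintype.prod_prod_type]
    refine Finset.prod_congr rfl fun i _ => ?_
    rw [← Finset.prod_filter]
    congr 1
    ext j
    simp
  rw [h, ← Finset.prod_mul_distrib]
  exact Finset.prod_congr rfl fun p _ => by ring

/-- The constant value of the alternating quotient of a family of polynomials of degree `< n`. -/
def altConst {n : ℕ} (p : Fin n → ℂ[X]) : ℂ :=
  (∏ _q ∈ Finset.univ.filter fun q : Fin n × Fin n => q.1 < q.2, (-1 : ℂ)) *
    (Matrix.of fun i j : Fin n => (p j).coeff i).det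

theorem altConst_eq_zero {n N : ℕ} (hN : N < n) (p : Fin n → ℂ[X])
    (hp : ∀ k, (p k).degree < N) : altConst p = 0 := by
  rw [altConst, Matrix.det_eq_zero_of_row_eq_zero ⟨N, hN⟩, mul_zero]
  intro j
  exact coeff_eq_zero_of_degree_lt (hp j)

theorem sum_perm_prod_eval_div {n : ℕ} (p : Fin n → ℂ[X]) (hp : ∀ k, (p k).degree < n)
    (x : Fin n → ℂ) (hx : Function.Injective x) :
    ∑ σ : Equiv.Perm (Fin n), (∏ k, (p k).eval (x (σ⁻¹ k))) /
      (∏ q ∈ Finset.univ.filter fun q : Fin n × Fin n => q.1 < q.2,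
        (x (σ⁻¹ q.1) - x (σ⁻¹ q.2))) = altConst p := by
  set s : ℂ := ∏ _q ∈ Finset.univ.filter fun q : Fin n × Fin n => q.1 < q.2, (-1 : ℂ) with hs
  have hs2 : s * s = 1 := by
    rw [hs, ← Finset.prod_mul_distrib]
    simp
  have hV : (Matrix.vandermonde x).det ≠ 0 := Matrix.det_vandermonde_ne_zero_iff.2 hx
  have hdet : (Matrix.of fun i j : Fin n => (p j).eval (x i)).det =
      (Matrix.vandermonde x).det * (Matrix.of fun i j : Fin n => (p j).coeff i).det := by
    rw [← Matrix.det_mul]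
    congr 1
    ext i j
    have hd : (p j).natDegree < n ∨ p j = 0 := by
      by_cases h0 : p j = 0
      · exact Or.inr h0
      · exact Or.inl ((natDegree_lt_iff_degree_lt h0).2 (hp j))
    have he : (p j).eval (x i) = ∑ k ∈ Finset.range n, (p j).coeff k * x i ^ k := by
      rcases hd with hd | hd
      · exact eval_eq_sum_range' hd _
      · simp [hd]
    rw [Matrix.of_apply, he, Matrix.mul_apply, Finset.sum_range]
    simp [Matrix.vandermonde_apply, mul_comm]
  rw [← Equiv.sum_comp (Equiv.inv (Equiv.Perm (Fin n)))]
  have hterm : ∀ σ : Equiv.Perm (Fin n), (∏ k, (p k).eval (x (σ k))) /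
      (∏ q ∈ Finset.univ.filter fun q : Fin n × Fin n => q.1 < q.2, (x (σ q.1) - x (σ q.2))) =
      (s / (Matrix.vandermonde x).det) *
        ((Equiv.Perm.sign σ : ℤ) * ∏ k, (p k).eval (x (σ k))) := by
    intro σ
    have h1 := prod_lt_sub_eq (fun k => x (σ k))
    have h2 : (Matrix.vandermonde fun k => x (σ k)).det =
        (Equiv.Perm.sign σ : ℤ) * (Matrix.vandermonde x).det := by
      rw [← Matrix.det_permute]
      rfl
    have h3 : ((Equiv.Perm.sign σ : ℤ) : ℂ) * ((Equiv.Perm.sign σ : ℤ) : ℂ) = 1 := by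
      rcases Int.units_eq_one_or (Equiv.Perm.sign σ) with h | h <;> simp [h]
    rw [h1, h2, ← hs]
    have hs0 : s ≠ 0 := left_ne_zero_of_mul_eq_one hs2
    have h30 := left_ne_zero_of_mul_eq_one h3
    field_simp
    linear_combination (-∏ k, (p k).eval (x (σ k))) * (s ^ 2 * h3 + hs2)
  simp only [Equiv.inv_apply, inv_inv]
  rw [Finset.sum_congr rfl fun σ _ => hterm σ, ← Finset.mul_sum]
  have hD := Matrix.det_apply' (Matrix.of fun i j : Fin n => (p j).eval (x i))
  simp only [Matrix.of_apply] at hD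
  rw [← hD, hdet, altConst, ← hs]
  field_simp

/-- Symmetrization of `z ^ k / (1 - z)` under inversion, as a polynomial in `z + z⁻¹`. -/
theorem exists_poly_symm_one_sub (N : ℕ) (k : ℤ) (h1 : -(N : ℤ) < k) (h2 : k ≤ N) :
    ∃ p : ℂ[X], p.degree < N ∧ ∀ z : ℂ, z ≠ 0 → z ≠ 1 →
      z ^ k / (1 - z) + z⁻¹ ^ k / (1 - z⁻¹) = p.eval (z + z⁻¹) := by
  have key : ∀ z : ℂ, z ≠ 0 → z ≠ 1 → ∀ k : ℤ,
      z ^ k / (1 - z) + z⁻¹ ^ k / (1 - z⁻¹) = (z ^ k - z * z⁻¹ ^ k) / (1 - z) := by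
    intro z hz0 hz1 k
    have h1 : (1 : ℂ) - z ≠ 0 := sub_ne_zero.2 hz1.symm
    have h2 : z - 1 ≠ 0 := sub_ne_zero.2 hz1
    have h3 : (1 : ℂ) - z⁻¹ = -((1 - z) / z) := by field_simp; ring
    rw [h3]
    field_simp
    ring
  have pos : ∀ n : ℕ, ∃ p : ℂ[X], p.degree < (n + 1 : ℕ) ∧ ∀ z : ℂ, z ≠ 0 → z ≠ 1 →
      (z ^ (n + 1 : ℤ) - z * z⁻¹ ^ (n + 1 : ℤ)) / (1 - z) = p.eval (z + z⁻¹) := by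
    intro n
    induction n using Nat.twoStepInduction with
    | zero =>
      refine ⟨-1, by simp, fun z hz0 hz1 => ?_⟩
      have h1 : (1 : ℂ) - z ≠ 0 := sub_ne_zero.2 hz1.symm
      simp
      field_simp
      ring
    | one =>
      refine ⟨-(X + C 1), ?_, fun z hz0 hz1 => ?_⟩
      · rw [degree_neg, degree_X_add_C]
        norm_num
      · have h1 : (1 : ℂ) - z ≠ 0 := sub_ne_zero.2 hz1.symm
        have h2 : ((1 : ℕ) : ℤ) + 1 = (2 : ℕ) := rfl
        rw [h2, zpow_natCast, zpow_natCast]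
        simp
        field_simp
        ring
    | more n ih1 ih2 =>
      obtain ⟨p, hp, hpe⟩ := ih1
      obtain ⟨r, hr, hre⟩ := ih2
      refine ⟨X * r - p, ?_, fun z hz0 hz1 => ?_⟩
      · refine (degree_sub_le _ _).trans_lt (max_lt ?_ (hp.trans ?_))
        · by_cases h0 : r = 0
          · simp [h0]
            exact WithBot.bot_lt_coe _
          · have := (natDegree_lt_iff_degree_lt h0).2 hr
            rw [degree_eq_natDegree (mul_ne_zero X_ne_zero h0), natDegree_X_mul h0]
            exact_mod_cast (by omega)
        · exact_mod_cast (by omega)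
      · have h1 : (1 : ℂ) - z ≠ 0 := sub_ne_zero.2 hz1.symm
        rw [eval_sub, eval_mul, eval_X, ← hpe z hz0 hz1, ← hre z hz0 hz1]
        have e1 : (((n + 2 : ℕ) : ℤ) + 1) = (n : ℤ) + 1 + 1 + 1 := by push_cast; ring
        have e2 : (((n + 1 : ℕ) : ℤ) + 1) = (n : ℤ) + 1 + 1 := by push_cast; ring
        have hi := inv_ne_zero hz0
        rw [e1, e2]
        simp only [zpow_add_one₀ hz0, zpow_add_one₀ hi]
        generalize z ^ (n : ℤ) = A
        generalize z⁻¹ ^ (n : ℤ) = B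
        field_simp
        ring
  rcases le_or_gt 1 k with hk | hk
  · obtain ⟨n, rfl⟩ : ∃ n : ℕ, k = n + 1 := ⟨(k - 1).toNat, by omega⟩
    obtain ⟨p, hp, he⟩ := pos n
    refine ⟨p, hp.trans_le (by exact_mod_cast (by omega)), fun z hz0 hz1 => ?_⟩
    rw [key z hz0 hz1, he z hz0 hz1]
  · obtain ⟨n, rfl⟩ : ∃ n : ℕ, k = -n := ⟨(-k).toNat, by omega⟩
    obtain ⟨p, hp, he⟩ := pos n
    refine ⟨-p, ?_, fun z hz0 hz1 => ?_⟩
    · rw [degree_neg]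
      exact hp.trans_le (by exact_mod_cast (by omega))
    · rw [key z hz0 hz1, eval_neg, ← he z hz0 hz1, zpow_add_one₀ hz0,
        zpow_add_one₀ (inv_ne_zero hz0)]
      simp only [zpow_neg, inv_zpow, inv_inv]
      field_simp
      ring

/-- Symmetrization of `z ^ k / (z⁻¹ - z)` under inversion, as a polynomial in `z + z⁻¹`. -/
theorem exists_poly_symm_inv_sub (N : ℕ) (k : ℤ) (h1 : -(N : ℤ) ≤ k) (h2 : k ≤ N) :
    ∃ p : ℂ[X], p.degree < N ∧ ∀ z : ℂ, z ≠ 0 → z⁻¹ - z ≠ 0 →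
      z ^ k / (z⁻¹ - z) + z⁻¹ ^ k / (z⁻¹⁻¹ - z⁻¹) = p.eval (z + z⁻¹) := by
  have key : ∀ z : ℂ, z⁻¹ - z ≠ 0 → ∀ k : ℤ,
      z ^ k / (z⁻¹ - z) + z⁻¹ ^ k / (z⁻¹⁻¹ - z⁻¹) = (z ^ k - z⁻¹ ^ k) / (z⁻¹ - z) := by
    intro z hz1 k
    rw [inv_inv, show z - z⁻¹ = -(z⁻¹ - z) by ring, div_neg, sub_div, ← sub_eq_add_neg]
  have pos : ∀ n : ℕ, ∃ p : ℂ[X], p.degree < n ∧ ∀ z : ℂ, z ≠ 0 → z⁻¹ - z ≠ 0 →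
      (z ^ (n : ℤ) - z⁻¹ ^ (n : ℤ)) / (z⁻¹ - z) = p.eval (z + z⁻¹) := by
    intro n
    induction n using Nat.twoStepInduction with
    | zero => exact ⟨0, by simp, by simp⟩
    | one =>
      refine ⟨-1, by simp, fun z hz0 hz1 => ?_⟩
      rw [div_eq_iff hz1]
      simp
    | more n ih1 ih2 =>
      obtain ⟨p, hp, hpe⟩ := ih1
      obtain ⟨r, hr, hre⟩ := ih2
      refine ⟨X * r - p, ?_, fun z hz0 hz1 => ?_⟩
      · refine (degree_sub_le _ _).trans_lt (max_lt ?_ (hp.trans ?_))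
        · by_cases h0 : r = 0
          · simp [h0]
            exact WithBot.bot_lt_coe _
          · have := (natDegree_lt_iff_degree_lt h0).2 hr
            rw [degree_eq_natDegree (mul_ne_zero X_ne_zero h0), natDegree_X_mul h0]
            exact_mod_cast (by omega)
        · exact_mod_cast (by omega)
      · rw [eval_sub, eval_mul, eval_X, ← hpe z hz0 hz1, ← hre z hz0 hz1]
        simp only [zpow_natCast, pow_succ]
        rw [mul_div_assoc', ← sub_div]
        congr 1
        linear_combination (z⁻¹ ^ n - z ^ n) * mul_inv_cancel₀ hz0
  rcases le_or_gt 0 k with hk | hk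
  · obtain ⟨n, rfl⟩ : ∃ n : ℕ, k = n := ⟨k.toNat, by omega⟩
    obtain ⟨p, hp, he⟩ := pos n
    refine ⟨p, hp.trans_le (by exact_mod_cast (by omega)), fun z hz0 hz1 => ?_⟩
    rw [key z hz1, he z hz0 hz1]
  · obtain ⟨n, rfl⟩ : ∃ n : ℕ, k = -n := ⟨(-k).toNat, by omega⟩
    obtain ⟨p, hp, he⟩ := pos n
    refine ⟨-p, ?_, fun z hz0 hz1 => ?_⟩
    · rw [degree_neg]
      exact hp.trans_le (by exact_mod_cast (by omega))
    · rw [key z hz1, eval_neg, ← he z hz0 hz1]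
      simp only [zpow_neg, inv_zpow, inv_inv]
      ring

theorem sact_ne_zero {n : ℕ} {a : Fin n → ℂ} (ha : ∀ i, a i ≠ 0) (w : SignedPerm n) (k : Fin n) :
    sact w a k ≠ 0 := by
  unfold sact
  split_ifs
  · exact inv_ne_zero (ha _)
  · exact ha _

/-- The factors `d_1` and `d_0`, up to a monomial: `∏ h(a_i)` times the Vandermonde product in the
variables `a_i + a_i⁻¹`. -/
def altDenom {n : ℕ} (h : ℂ → ℂ) (a : Fin n → ℂ) : ℂ :=
  (∏ i, h (a i)) * ∏ q ∈ Finset.univ.filter fun q : Fin n × Fin n => q.1 < q.2,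
    ((a q.1 + (a q.1)⁻¹) - (a q.2 + (a q.2)⁻¹))

/-- The alternating quotient attached to the monomial `a ^ μ`. -/
def altSum {n : ℕ} (h : ℂ → ℂ) (μ : Fin n → ℤ) (a : Fin n → ℂ) : ℂ :=
  ∑ w : SignedPerm n, (∏ i, sact w a i ^ μ i) / altDenom h (sact w a)

theorem altSum_eq_altConst {n : ℕ} (h : ℂ → ℂ) (μ : Fin n → ℤ) (p : Fin n → ℂ[X])
    (hp : ∀ k, (p k).degree < n) (a : Fin n → ℂ)
    (hpa : ∀ k i, a i ^ μ k / h (a i) + (a i)⁻¹ ^ μ k / h (a i)⁻¹ =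
      (p k).eval (a i + (a i)⁻¹))
    (hinj : Function.Injective fun i => a i + (a i)⁻¹) :
    altSum h μ a = altConst p := by
  rw [← sum_perm_prod_eval_div p hp _ hinj, altSum, Fintype.sum_prod_type, Finset.sum_comm]
  refine Finset.sum_congr rfl fun σ _ => ?_
  have hx : ∀ (ε : Fin n → Bool) k, sact (ε, σ) a k + (sact (ε, σ) a k)⁻¹ =
      a (σ⁻¹ k) + (a (σ⁻¹ k))⁻¹ := by
    intro ε k
    simp only [sact]
    split_ifs
    · rw [inv_inv, add_comm]
    · rfl
  have hk : ∀ k, (p k).eval (a (σ⁻¹ k) + (a (σ⁻¹ k))⁻¹) =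
      ∑ e : Bool, (if e then (a (σ⁻¹ k))⁻¹ else a (σ⁻¹ k)) ^ μ k /
        h (if e then (a (σ⁻¹ k))⁻¹ else a (σ⁻¹ k)) := by
    intro k
    rw [← hpa, Fintype.sum_bool, add_comm]
    simp
  simp only [hk]
  rw [Fintype.prod_sum, Finset.sum_div]
  refine Finset.sum_congr rfl fun ε _ => ?_
  simp only [altDenom, hx]
  rw [← div_div, ← Finset.prod_div_distrib]
  rfl

theorem add_inv_injective {n : ℕ} (a : Fin n → ℂ) (ha0 : ∀ i, a i ≠ 0)
    (h1 : ∀ i j : Fin n, i < j → a i * a j ≠ 1) (h2 : ∀ i j : Fin n, i ≠ j → a i ≠ a j) :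
    Function.Injective fun i => a i + (a i)⁻¹ := by
  intro i j hij
  by_contra hne
  have h3 : a i * a j ≠ 1 := by
    rcases lt_or_gt_of_ne hne with h | h
    · exact h1 i j h
    · rw [mul_comm]; exact h1 j i h
  have hi := ha0 i
  have hj := ha0 j
  have : (a i - a j) * (a i * a j - 1) = 0 := by
    simp only at hij
    field_simp at hij
    linear_combination hij
  rcases mul_eq_zero.1 this with h | h
  · exact h2 i j hne (sub_eq_zero.1 h)
  · exact h3 (sub_eq_zero.1 h)

theorem altSum_one_sub_const (n : ℕ) (μ : Fin n → ℤ) (hμ : ∀ i, -(n : ℤ) < μ i ∧ μ i ≤ n) :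
    ∃ C, ∀ a : Fin n → ℂ, (∀ i, a i ≠ 0) → BRegular n a → altSum (fun z => 1 - z) μ a = C := by
  choose p hp hpe using fun i => exists_poly_symm_one_sub n (μ i) (hμ i).1 (hμ i).2
  exact ⟨altConst p, fun a ha0 ha => altSum_eq_altConst _ μ p hp a
    (fun k i => hpe k (a i) (ha0 i) (ha.1 i)) (add_inv_injective a ha0 ha.2.1 ha.2.2)⟩

theorem altSum_one_sub_eq_zero {n N : ℕ} (hN : N < n) (μ : Fin n → ℤ)
    (hμ : ∀ i, -(N : ℤ) < μ i ∧ μ i ≤ N) (a : Fin n → ℂ) (ha0 : ∀ i, a i ≠ 0)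
    (ha : BRegular n a) : altSum (fun z => 1 - z) μ a = 0 := by
  choose p hp hpe using fun i => exists_poly_symm_one_sub N (μ i) (hμ i).1 (hμ i).2
  rw [altSum_eq_altConst _ μ p (fun k => (hp k).trans (by exact_mod_cast hN)) a
    (fun k i => hpe k (a i) (ha0 i) (ha.1 i)) (add_inv_injective a ha0 ha.2.1 ha.2.2)]
  exact altConst_eq_zero hN p hp

theorem altSum_inv_sub_const (n : ℕ) (ν : Fin n → ℤ) (hν : ∀ i, -(n : ℤ) ≤ ν i ∧ ν i ≤ n) :
    ∃ C, ∀ b : Fin n → ℂ, (∀ i, b i ≠ 0) → CRegular n b →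
      altSum (fun z => z⁻¹ - z) ν b = C := by
  choose p hp hpe using fun i => exists_poly_symm_inv_sub n (ν i) (hν i).1 (hν i).2
  refine ⟨altConst p, fun b hb0 hb => altSum_eq_altConst _ ν p hp b
    (fun k i => hpe k (b i) (hb0 i) ?_)
    (add_inv_injective b hb0 (fun i j hij => hb.1 i j hij.le) hb.2)⟩
  intro h
  apply hb.1 i i le_rfl
  have := hb0 i
  field_simp at h
  linear_combination -h

theorem zpow_sum {ι : Type*} (s : Finset ι) (z : ℂ) (hz : z ≠ 0) (f : ι → ℤ) :
    z ^ (∑ i ∈ s, f i) = ∏ i ∈ s, z ^ f i := by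
  classical
  induction s using Finset.induction_on with
  | empty => simp
  | insert i s hi ih => rw [Finset.sum_insert hi, Finset.prod_insert hi, zpow_add₀ hz, ih]

/-- The sign `±1`. -/
def sgnExp (s : Bool) : ℤ := if s then 1 else -1

/-- Exponent of `a_i` in the monomial selected by `k`. -/
def expA (k : Bool × Bool) : ℤ := if k.1 then sgnExp k.2 else 0

/-- Exponent of `b_j` in the monomial selected by `k`. -/
def expB (k : Bool × Bool) : ℤ := if k.1 then 0 else sgnExp k.2

/-- Coefficient of the monomial selected by `k` in the normalized factor of index `(i, j)`;
`r` records whether `i ≤ j`. -/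
def coefAB (t : ℂ) (r : Bool) (k : Bool × Bool) : ℂ :=
  if k.1 = r then (if k.2 then t ^ 2 else 1) else -t

theorem sum_coefAB_true (t x y : ℂ) (hx : x ≠ 0) (hy : y ≠ 0) :
    ∑ k, coefAB t true k * (x ^ expA k * y ^ expB k) =
      x⁻¹ * ((1 - t * x * y) * (1 - t * x * y⁻¹)) := by
  rw [Fintype.sum_prod_type]
  simp [coefAB, expA, expB, sgnExp]
  field_simp
  ring

theorem sum_coefAB_false (t x y : ℂ) (hx : x ≠ 0) (hy : y ≠ 0) :
    ∑ k, coefAB t false k * (x ^ expA k * y ^ expB k) =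
      y⁻¹ * ((1 - t * x * y) * (1 - t * x⁻¹ * y)) := by
  rw [Fintype.sum_prod_type]
  simp [coefAB, expA, expB, sgnExp]
  field_simp
  ring

/-- The numerator of Case B divided by a monomial. -/
def numAB (m : ℕ) (t : ℂ) (a : Fin (m + 1) → ℂ) (b : Fin m → ℂ) : ℂ :=
  (∏ i, (1 - t * a i)) * ∏ i : Fin (m + 1), ∏ j : Fin m,
    ∑ k, coefAB t (decide ((i : ℕ) ≤ j)) k * (a i ^ expA k * b j ^ expB k)

/-- Exponent of `a_i` in a monomial of the expanded numerator. -/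
def muAB {m : ℕ} (x : (Fin (m + 1) → Bool) × (Fin (m + 1) → Fin m → Bool × Bool))
    (i : Fin (m + 1)) : ℤ := (if x.1 i then 1 else 0) + ∑ j, expA (x.2 i j)

/-- Exponent of `b_j` in a monomial of the expanded numerator. -/
def nuAB {m : ℕ} (x : (Fin (m + 1) → Bool) × (Fin (m + 1) → Fin m → Bool × Bool))
    (j : Fin m) : ℤ := ∑ i, expB (x.2 i j)

/-- Coefficient of a monomial of the expanded numerator. -/
def termCoef {m : ℕ} (t : ℂ)
    (x : (Fin (m + 1) → Bool) × (Fin (m + 1) → Fin m → Bool × Bool)) : ℂ :=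
  (∏ i, if x.1 i then -t else 1) *
    ∏ i : Fin (m + 1), ∏ j : Fin m, coefAB t (decide ((i : ℕ) ≤ j)) (x.2 i j)

theorem numAB_eq_sum (m : ℕ) (t : ℂ) (a : Fin (m + 1) → ℂ) (b : Fin m → ℂ)
    (ha : ∀ i, a i ≠ 0) (hb : ∀ i, b i ≠ 0) :
    numAB m t a b = ∑ x, termCoef t x * ((∏ i, a i ^ muAB x i) * ∏ j, b j ^ nuAB x j) := by
  have h1 : ∀ i, (1 - t * a i) = ∑ u : Bool, if u then -t * a i else 1 := by
    intro i
    simp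
    ring
  rw [numAB, Fintype.sum_prod_type]
  simp only [h1, Fintype.prod_sum]
  rw [Finset.sum_mul_sum]
  refine Finset.sum_congr rfl fun u _ => Finset.sum_congr rfl fun κ _ => ?_
  have hA : ∀ i, a i ^ muAB (u, κ) i = (if u i then a i else 1) * ∏ j, a i ^ expA (κ i j) := by
    intro i
    rw [muAB, zpow_add₀ (ha i), zpow_sum _ _ (ha i)]
    split_ifs <;> simp
  have hB : ∏ j, b j ^ nuAB (u, κ) j = ∏ i, ∏ j, b j ^ expB (κ i j) := by
    rw [Finset.prod_comm]
    exact Finset.prod_congr rfl fun j _ => zpow_sum _ _ (hb j) _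
  have hU : ∀ i, (if u i then -t * a i else 1) =
      (if u i then -t else 1) * (if u i then a i else 1) := by
    intro i
    split_ifs <;> simp
  simp only [hA, hB, hU, termCoef, Finset.prod_mul_distrib]
  ring

theorem abs_sgnExp (s : Bool) : |sgnExp s| = 1 := by
  cases s <;> simp [sgnExp]

theorem abs_expA_add_abs_expB (k : Bool × Bool) : |expA k| + |expB k| = 1 := by
  rcases k with ⟨_ | _, s⟩ <;> simp [expA, expB, abs_sgnExp]

theorem abs_sum_expA_le {m : ℕ} (κ : Fin m → Bool × Bool) : |∑ j, expA (κ j)| ≤ m := by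
  refine (Finset.abs_sum_le_sum_abs _ _).trans ?_
  refine (Finset.sum_le_card_nsmul _ _ 1 fun j _ => ?_).trans (by simp)
  have := abs_expA_add_abs_expB (κ j)
  have := abs_nonneg (expB (κ j))
  lia

theorem abs_sum_expB_lt {n : ℕ} (κ : Fin (n + 1) → Bool × Bool) (i : Fin (n + 1))
    (hi : expB (κ i) = 0) : |∑ j, expB (κ j)| ≤ n := by
  rw [Fin.sum_univ_succAbove _ i, hi, zero_add]
  refine (Finset.abs_sum_le_sum_abs _ _).trans ?_
  refine (Finset.sum_le_card_nsmul _ _ 1 fun j _ => ?_).trans (by simp)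
  have := abs_expA_add_abs_expB (κ (i.succAbove j))
  have := abs_nonneg (expA (κ (i.succAbove j)))
  lia

theorem abs_sum_expA_lt {m : ℕ} (κ : Fin m → Bool × Bool) (j : Fin m)
    (hj : expA (κ j) = 0) : |∑ j, expA (κ j)| + 1 ≤ m := by
  obtain ⟨n, rfl⟩ : ∃ n, m = n + 1 := ⟨m - 1, by have := j.2; omega⟩
  rw [Fin.sum_univ_succAbove _ j, hj, zero_add]
  have := abs_sum_expA_le fun l => κ (j.succAbove l)
  push_cast
  lia

/-- Each monomial of the expanded numerator contributes a constant. -/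
theorem altSum_mul_altSum_const (m : ℕ)
    (x : (Fin (m + 1) → Bool) × (Fin (m + 1) → Fin m → Bool × Bool)) :
    ∃ C, ∀ (a : Fin (m + 1) → ℂ) (b : Fin m → ℂ), (∀ i, a i ≠ 0) → (∀ i, b i ≠ 0) →
      BRegular (m + 1) a → CRegular m b →
      altSum (fun z => 1 - z) (muAB x) a * altSum (fun z => z⁻¹ - z) (nuAB x) b = C := by
  by_cases h : ∃ j, ∀ i, expA (x.2 i j) = 0
  · obtain ⟨j, hj⟩ := h
    refine ⟨0, fun a b ha0 hb0 ha hb => ?_⟩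
    rw [altSum_one_sub_eq_zero (Nat.lt_succ_self m) _ (fun i => ?_) a ha0 ha, zero_mul]
    have h1 := abs_sum_expA_lt (x.2 i) j (hj i)
    have h2 := abs_le.1 (show |∑ j, expA (x.2 i j)| ≤ (m : ℤ) - 1 by lia)
    unfold muAB
    split_ifs <;> constructor <;> lia
  · push Not at h
    obtain ⟨C, hC⟩ := altSum_one_sub_const (m + 1) (muAB x) fun i => by
      have h2 := abs_le.1 (abs_sum_expA_le (x.2 i))
      unfold muAB
      split_ifs <;> constructor <;> push_cast <;> lia
    obtain ⟨C', hC'⟩ := altSum_inv_sub_const m (nuAB x) fun j => by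
      obtain ⟨i, hi⟩ := h j
      have hB : expB (x.2 i j) = 0 := by
        have h1 := abs_expA_add_abs_expB (x.2 i j)
        have h2 := abs_pos.2 hi
        have h3 := abs_nonneg (expB (x.2 i j))
        exact abs_eq_zero.1 (by lia)
      exact abs_le.1 (abs_sum_expB_lt (fun i => x.2 i j) i hB)
    exact ⟨C * C', fun a b ha0 hb0 ha hb => by rw [hC a ha0 ha, hC' b hb0 hb]⟩

theorem prod_filter_lt_fst_succ (m : ℕ) (f : Fin (m + 1) → ℂ) :
    ∏ p ∈ Finset.univ.filter fun p : Fin (m + 1) × Fin (m + 1) => p.1 < p.2, f p.1 =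
      ∏ i : Fin (m + 1), ∏ j : Fin m, if (i : ℕ) ≤ j then f i else 1 := by
  rw [Finset.prod_filter, Fintype.prod_prod_type]
  refine Finset.prod_congr rfl fun i _ => ?_
  rw [Fin.prod_univ_succ, if_neg (Fin.not_lt_zero i), one_mul]
  simp [Fin.lt_def]

theorem prod_mul_prod_filter_lt_fst (m : ℕ) (f : Fin m → ℂ) :
    (∏ i, f i) * ∏ p ∈ Finset.univ.filter fun p : Fin m × Fin m => p.1 < p.2, f p.1 =
      ∏ i : Fin (m + 1), ∏ j : Fin m, if (i : ℕ) ≤ j then 1 else f j := by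
  have h0 : ∏ j : Fin m, (if ((0 : Fin (m + 1)) : ℕ) ≤ j then 1 else f j) = 1 :=
    Finset.prod_eq_one fun j _ => if_pos (Nat.zero_le _)
  have hd : ∀ j, f j = ∏ i, if i = j then f j else 1 := fun j => by simp
  rw [Finset.prod_filter, Fintype.prod_prod_type, Fin.prod_univ_succ, h0, one_mul,
    Finset.prod_comm (s := Finset.univ (α := Fin m)) (t := Finset.univ (α := Fin m)),
    Finset.prod_comm, ← Finset.prod_mul_distrib, Finset.prod_comm (γ := Fin m)]
  refine Finset.prod_congr rfl fun j _ => ?_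
  nth_rewrite 1 [hd j]
  rw [← Finset.prod_mul_distrib]
  refine Finset.prod_congr rfl fun i _ => ?_
  simp only [Fin.val_succ, Nat.succ_le_iff, Fin.lt_def, Fin.ext_iff]
  split_ifs <;> first | omega | simp

theorem d1B_eq (m : ℕ) (a : Fin (m + 1) → ℂ) (ha : ∀ i, a i ≠ 0) :
    d1B m a = (∏ i : Fin (m + 1), ∏ j : Fin m, if (i : ℕ) ≤ j then a i else 1) *
      altDenom (fun z => 1 - z) a := by
  rw [← prod_filter_lt_fst_succ, d1B, altDenom, mul_left_comm, ← Finset.prod_mul_distrib]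
  congr 1
  refine Finset.prod_congr rfl fun p _ => ?_
  have h1 := ha p.1
  have h2 := ha p.2
  field_simp
  ring

theorem d0B_eq (m : ℕ) (b : Fin m → ℂ) (hb : ∀ i, b i ≠ 0) :
    d0B m b = (∏ i : Fin (m + 1), ∏ j : Fin m, if (i : ℕ) ≤ j then 1 else b j) *
      altDenom (fun z => z⁻¹ - z) b := by
  rw [← prod_mul_prod_filter_lt_fst, d0B, altDenom, mul_mul_mul_comm,
    ← Finset.prod_mul_distrib, ← Finset.prod_mul_distrib]
  congr 1
  · refine Finset.prod_congr rfl fun i _ => ?_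
    have h1 := hb i
    field_simp
  · refine Finset.prod_congr rfl fun p _ => ?_
    have h1 := hb p.1
    have h2 := hb p.2
    field_simp
    ring

theorem bB_eq (m : ℕ) (t : ℂ) (a : Fin (m + 1) → ℂ) (b : Fin m → ℂ)
    (ha : ∀ i, a i ≠ 0) (hb : ∀ i, b i ≠ 0) :
    bB m t a b = (∏ i : Fin (m + 1), ∏ j : Fin m, if (i : ℕ) ≤ j then a i else 1) *
      (∏ i : Fin (m + 1), ∏ j : Fin m, if (i : ℕ) ≤ j then 1 else b j) * numAB m t a b := by
  have h1 : (∏ p ∈ Finset.univ.filter fun p : Fin m × Fin m => p.1 ≤ p.2,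
      ((1 - t * a p.1.castSucc * b p.2) * (1 - t * a p.1.castSucc * (b p.2)⁻¹))) =
      ∏ i : Fin (m + 1), ∏ j : Fin m, if (i : ℕ) ≤ j then
        (1 - t * a i * b j) * (1 - t * a i * (b j)⁻¹) else 1 := by
    have hl : ∏ j : Fin m, (if ((Fin.last m : Fin (m + 1)) : ℕ) ≤ j then
        (1 - t * a (Fin.last m) * b j) * (1 - t * a (Fin.last m) * (b j)⁻¹) else 1) = 1 :=
      Finset.prod_eq_one fun j _ => if_neg (by simp)
    rw [Fin.prod_univ_castSucc, hl, mul_one, Finset.prod_filter, Fintype.prod_prod_type]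
    rfl
  rw [bB, h1, Finset.prod_filter, Fintype.prod_prod_type, numAB, mul_assoc,
    mul_left_comm (_ * _)]
  congr 1
  simp only [← Finset.prod_mul_distrib]
  refine Finset.prod_congr rfl fun i _ => Finset.prod_congr rfl fun j _ => ?_
  by_cases h : (i : ℕ) ≤ j
  · rw [if_pos h, if_neg (by simpa using h), if_pos h, if_pos h, decide_eq_true h,
      sum_coefAB_true t _ _ (ha i) (hb j)]
    have := ha i
    field_simp
  · rw [if_neg h, if_pos (by simpa using h), if_neg h, if_neg h, decide_eq_false h,
      sum_coefAB_false t _ _ (ha i) (hb j)]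
    have := hb j
    field_simp

theorem cB_eq (m : ℕ) (t : ℂ) (a : Fin (m + 1) → ℂ) (b : Fin m → ℂ)
    (ha : ∀ i, a i ≠ 0) (hb : ∀ i, b i ≠ 0) :
    cB m t a b = numAB m t a b /
      (altDenom (fun z => 1 - z) a * altDenom (fun z => z⁻¹ - z) b) := by
  rw [cB, bB_eq m t a b ha hb, d1B_eq m a ha, d0B_eq m b hb, mul_mul_mul_comm]
  refine mul_div_mul_left _ _ (mul_ne_zero ?_ ?_)
  · refine Finset.prod_ne_zero_iff.2 fun i _ => Finset.prod_ne_zero_iff.2 fun j _ => ?_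
    split_ifs
    exacts [ha i, one_ne_zero]
  · refine Finset.prod_ne_zero_iff.2 fun i _ => Finset.prod_ne_zero_iff.2 fun j _ => ?_
    split_ifs
    exacts [one_ne_zero, hb j]

theorem AB_eq_sum (m : ℕ) (t : ℂ) (a : Fin (m + 1) → ℂ) (b : Fin m → ℂ)
    (ha : ∀ i, a i ≠ 0) (hb : ∀ i, b i ≠ 0) :
    AB m t a b = ∑ x, termCoef t x *
      (altSum (fun z => 1 - z) (muAB x) a * altSum (fun z => z⁻¹ - z) (nuAB x) b) := by
  have h : ∀ w' w, cB m t (sact w' a) (sact w b) = ∑ x, termCoef t x *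
      ((∏ i, sact w' a i ^ muAB x i) / altDenom (fun z => 1 - z) (sact w' a) *
        ((∏ j, sact w b j ^ nuAB x j) / altDenom (fun z => z⁻¹ - z) (sact w b))) := by
    intro w' w
    rw [cB_eq m t _ _ (sact_ne_zero ha w') (sact_ne_zero hb w),
      numAB_eq_sum m t _ _ (sact_ne_zero ha w') (sact_ne_zero hb w), Finset.sum_div]
    refine Finset.sum_congr rfl fun x _ => ?_
    rw [mul_div_assoc, mul_div_mul_comm]
  simp only [AB, h, altSum, Finset.sum_mul_sum]
  simp only [Finset.mul_sum]
  refine Eq.trans ?_ Finset.sum_comm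
  refine Finset.sum_congr rfl fun w' _ => ?_
  exact Finset.sum_comm

/-- Case B of the paper's Lemma: the Weyl-group sum `A_{Ξ,ξ}` is independent of the
regular pair `(Ξ, ξ)`. -/
theorem stmt5 (m : ℕ) (hm : 1 ≤ m) (q : ℝ) (hq : 1 < q) (t : ℂ)
    (ht : t = ((Real.sqrt q)⁻¹ : ℝ))
    (a a' : Fin (m + 1) → ℂ) (b b' : Fin m → ℂ)
    (ha0 : ∀ i, a i ≠ 0) (hb0 : ∀ i, b i ≠ 0) (ha'0 : ∀ i, a' i ≠ 0) (hb'0 : ∀ i, b' i ≠ 0)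
    (ha : BRegular (m + 1) a) (ha' : BRegular (m + 1) a')
    (hb : CRegular m b) (hb' : CRegular m b') :
    AB m t a b = AB m t a' b' := by
  choose C hC using altSum_mul_altSum_const m
  rw [AB_eq_sum m t a b ha0 hb0, AB_eq_sum m t a' b' ha'0 hb'0]
  refine Finset.sum_congr rfl fun x _ => ?_
  rw [hC x a b ha0 hb0 ha hb, hC x a' b' ha'0 hb'0 ha' hb']

end GrossPrasadCaseB
end
end

section
/- Fix an integer l ≥ 1 and a real number q > 1, and set t := q^{−1/2}. For every GL-regular l-tuple a and every B-regular l-tuple b of nonzero complex numbers, A_A(t; a, b) = ∏_{k=1}^{l} (1 + t^{2k−1})(1 − t^{2k}). Equivalently, writing q_F := t^{−1}, A_A(t;a,b) = ( L(1,χ)·ζ(2)·L(3,χ)·ζ(4) ⋯ L(2l−1,χ)·ζ(2l) )^{−1}, where ζ(s) = (1 − q_F^{−s})^{−1} and L(s,χ) = (1 + q_F^{−s})^{−1}. -/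
noncomputable section

namespace GrossPrasadCaseA

open Finset Polynomial Topology

/-- `signedInv ε x` is `x⁻¹` or `x`, according to the sign `ε`. -/
def signedInv (ε : Bool) (x : ℂ) : ℂ := if ε then x⁻¹ else x

/-- The product `∏ᵢ (1 - s x cᵢ)(1 - s x cᵢ⁻¹)`, invariant under signed permutations of `c`. -/
def pairProd {n : ℕ} (s x : ℂ) (c : Fin n → ℂ) : ℂ :=
  ∏ i, (1 - s * x * c i) * (1 - s * x * (c i)⁻¹)

/-- The tuple obtained from `a` by moving `a 0` to position `p` and dropping the first entry. -/
def dropAt {n : ℕ} (p : Fin (n + 1)) (a : Fin (n + 1) → ℂ) : Fin n → ℂ :=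
  fun i => a (Equiv.swap 0 p i.succ)

lemma signedInv_ne_zero {x : ℂ} (hx : x ≠ 0) (ε : Bool) : signedInv ε x ≠ 0 := by
  cases ε <;> simp [signedInv, hx]

lemma sact_apply {n : ℕ} (w : SignedPerm n) (a : Fin n → ℂ) (k : Fin n) :
    sact w a k = signedInv (w.1 k) (a (w.2⁻¹ k)) := rfl

lemma pairProd_sact {n : ℕ} (s x : ℂ) (w : SignedPerm n) (c : Fin n → ℂ) :
    pairProd s x (sact w c) = pairProd s x c := by
  unfold pairProd
  rw [← Equiv.prod_comp w.2⁻¹ fun i => (1 - s * x * c i) * (1 - s * x * (c i)⁻¹)]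
  refine prod_congr rfl fun i _ => ?_
  rw [sact_apply]
  cases w.1 i <;> simp [signedInv, mul_comm]

lemma prod_dropAt {n : ℕ} (p : Fin (n + 1)) (a : Fin (n + 1) → ℂ) (f : ℂ → ℂ) :
    ∏ i, f (dropAt p a i) = ∏ j ∈ univ.erase p, f (a j) := by
  refine prod_bij (fun i _ => Equiv.swap 0 p i.succ) ?_ ?_ ?_ ?_
  · intro i _
    simp only [mem_erase, mem_univ, and_true]
    intro h
    rw [Equiv.swap_apply_eq_iff, Equiv.swap_apply_right] at h
    exact Fin.succ_ne_zero i h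
  · intro i _ j _ h
    simpa using h
  · intro j hj
    have h0 : Equiv.swap 0 p j ≠ 0 := by
      intro h
      rw [Equiv.swap_apply_eq_iff, Equiv.swap_apply_left] at h
      simp [h] at hj
    obtain ⟨i, hi⟩ := Fin.exists_succ_eq.2 h0
    exact ⟨i, mem_univ _, by rw [hi, Equiv.swap_apply_self]⟩
  · intro i _
    rfl

lemma GLRegular.mul_ne_one {n : ℕ} {a : Fin n → ℂ} (h : GLRegular n a) (i j : Fin n) :
    a i * a j ≠ 1 := by
  rcases le_total i j with hij | hij
  · exact h.1 i j hij
  · rw [mul_comm]; exact h.1 j i hij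

lemma GLRegular.dropAt {n : ℕ} {a : Fin (n + 1) → ℂ} (h : GLRegular (n + 1) a)
    (p : Fin (n + 1)) : GLRegular n (dropAt p a) :=
  ⟨fun _ _ _ => h.mul_ne_one _ _, fun _ _ hij => h.2 _ _ (by simpa using hij)⟩

lemma BRegular.mul_ne_one {n : ℕ} {b : Fin n → ℂ} (h : BRegular n b) {i j : Fin n}
    (hij : i ≠ j) : b i * b j ≠ 1 := by
  rcases lt_or_gt_of_ne hij with hij | hij
  · exact h.2.1 i j hij
  · rw [mul_comm]; exact h.2.1 j i hij

lemma BRegular.dropAt {n : ℕ} {b : Fin (n + 1) → ℂ} (h : BRegular (n + 1) b)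
    (p : Fin (n + 1)) : BRegular n (dropAt p b) :=
  ⟨fun _ => h.1 _, fun _ _ hij => h.mul_ne_one (by simpa using hij.ne),
    fun _ _ hij => h.2.2 _ _ (by simpa using hij)⟩

/-- Reindexing of a sum over the signed permutations of `n + 1` letters by the signed entry put
in first position. -/
lemma sum_sact_succ {n : ℕ} (a : Fin (n + 1) → ℂ) (f : (Fin (n + 1) → ℂ) → ℂ) :
    ∑ w : SignedPerm (n + 1), f (sact w a) =
      ∑ p : Fin (n + 1) × Bool, ∑ w : SignedPerm n,
        f (Fin.cons (signedInv p.2 (a p.1)) (sact w (dropAt p.1 a))) := by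
  let e : (Fin (n + 1) × Bool) × SignedPerm n ≃ SignedPerm (n + 1) :=
    { toFun := fun x => (Fin.cons x.1.2 x.2.1, (Equiv.Perm.decomposeFin.symm (x.1.1, x.2.2⁻¹))⁻¹)
      invFun := fun w => (((Equiv.Perm.decomposeFin w.2⁻¹).1, w.1 0),
        (Fin.tail w.1, (Equiv.Perm.decomposeFin w.2⁻¹).2⁻¹))
      left_inv := fun x => by simp
      right_inv := fun w => by simp }
  rw [← Fintype.sum_prod_type', ← e.sum_comp]
  refine sum_congr rfl fun x _ => congrArg f ?_
  funext k
  refine Fin.cases ?_ (fun i => ?_) k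
  · simp [sact_apply, e]
  · simp [sact_apply, e, dropAt]

lemma d1A_cons {n : ℕ} (x : ℂ) (a : Fin n → ℂ) :
    d1A (n + 1) (Fin.cons x a) = (1 - x ^ 2) * pairProd 1 x a * d1A n a := by
  simp only [d1A, pairProd, prod_filter, Fintype.prod_prod_type, Fin.prod_univ_succ,
    Fin.cons_zero, Fin.cons_succ, Fin.succ_lt_succ_iff, Fin.succ_pos, Fin.not_lt_zero, if_true,
    if_false, one_mul]
  ring

lemma d0A_cons {n : ℕ} (y : ℂ) (b : Fin n → ℂ) :
    d0A (n + 1) (Fin.cons y b) = (1 - y) * pairProd 1 y b * d0A n b := by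
  simp only [d0A, pairProd, prod_filter, Fintype.prod_prod_type, Fin.prod_univ_succ,
    Fin.cons_zero, Fin.cons_succ, Fin.succ_lt_succ_iff, Fin.succ_pos, Fin.not_lt_zero, if_true,
    if_false, one_mul]
  ring

lemma bA_cons {n : ℕ} (t x y : ℂ) (a b : Fin n → ℂ) :
    bA (n + 1) t (Fin.cons x a) (Fin.cons y b) =
      pairProd t x (Fin.cons y b : Fin (n + 1) → ℂ) * ((1 - t * y) * pairProd t y a)
        * bA n t a b := by
  have hcomm : ∏ i, (1 - t * a i * y) * (1 - t * (a i)⁻¹ * y) = pairProd t y a :=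
    prod_congr rfl fun i _ => by ring
  simp only [bA, prod_filter, Fintype.prod_prod_type, Fin.prod_univ_succ,
    Fin.cons_zero, Fin.cons_succ, Fin.succ_lt_succ_iff, Fin.succ_le_succ_iff, Fin.succ_pos,
    Fin.not_lt_zero, if_true, if_false, lt_irrefl, Fin.zero_le,
    Fin.le_zero_iff, Fin.succ_ne_zero, one_mul, prod_mul_distrib, prod_const_one] at hcomm ⊢
  rw [← hcomm]
  simp only [pairProd, Fin.prod_univ_succ, Fin.cons_zero, Fin.cons_succ, prod_mul_distrib]
  ring

lemma cA_cons {n : ℕ} (t x y : ℂ) (a b : Fin n → ℂ) :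
    cA (n + 1) t (Fin.cons x a) (Fin.cons y b) =
      pairProd t x (Fin.cons y b : Fin (n + 1) → ℂ) / ((1 - x ^ 2) * pairProd 1 x a) *
        ((1 - t * y) * pairProd t y a / ((1 - y) * pairProd 1 y b)) * cA n t a b := by
  rw [cA, cA, bA_cons, d1A_cons, d0A_cons, div_mul_div_comm, div_mul_div_comm]
  congr 1
  ring

lemma pairProd_cons_sact {n : ℕ} (s x : ℂ) (b : Fin (n + 1) → ℂ) (p : Fin (n + 1)) (ε : Bool)
    (w : SignedPerm n) :
    pairProd s x (Fin.cons (signedInv ε (b p)) (sact w (dropAt p b)) : Fin (n + 1) → ℂ) =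
      pairProd s x b := by
  have hw : (Fin.cons (signedInv ε (b p)) (sact w (dropAt p b)) : Fin (n + 1) → ℂ) =
      sact (Fin.cons ε w.1, (Equiv.Perm.decomposeFin.symm (p, w.2⁻¹))⁻¹) b := by
    funext k
    refine Fin.cases ?_ (fun i => ?_) k
    · simp [sact_apply]
    · simp [sact_apply, dropAt]
  rw [hw, pairProd_sact]

lemma AA_succ {n : ℕ} (t : ℂ) (a b : Fin (n + 1) → ℂ) :
    AA (n + 1) t a b = ∑ p : Fin (n + 1) × Bool,
      pairProd t (signedInv p.2 (a p.1)) b /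
        ((1 - signedInv p.2 (a p.1) ^ 2) * pairProd 1 (signedInv p.2 (a p.1)) (dropAt p.1 a)) *
      ∑ r : Fin (n + 1) × Bool,
        (1 - t * signedInv r.2 (b r.1)) * pairProd t (signedInv r.2 (b r.1)) (dropAt p.1 a) /
          ((1 - signedInv r.2 (b r.1)) * pairProd 1 (signedInv r.2 (b r.1)) (dropAt r.1 b)) *
        AA n t (dropAt p.1 a) (dropAt r.1 b) := by
  unfold AA
  simp_rw [sum_sact_succ b]
  rw [sum_sact_succ a fun a' => ∑ r : Fin (n + 1) × Bool, ∑ w : SignedPerm n,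
    cA (n + 1) t a' (Fin.cons (signedInv r.2 (b r.1)) (sact w (dropAt r.1 b)))]
  refine sum_congr rfl fun p _ => ?_
  rw [sum_comm, mul_sum]
  refine sum_congr rfl fun r _ => ?_
  simp only [cA_cons, pairProd_cons_sact, pairProd_sact, mul_sum, mul_assoc]

/-- Lagrange interpolation at `0` and at the points `cᵢ`, `cᵢ⁻¹`. -/
lemma sum_eval_div_one_sub_sq {n : ℕ} {c : Fin n → ℂ} (hc0 : ∀ i, c i ≠ 0)
    (hc : GLRegular n c) {P : ℂ[X]} (hP : P.natDegree ≤ 2 * n) :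
    ∑ p : Fin n × Bool, P.eval (signedInv p.2 (c p.1)) / ((1 - signedInv p.2 (c p.1) ^ 2) *
      ∏ j ∈ univ.erase p.1, (1 - signedInv p.2 (c p.1) * c j) *
        (1 - signedInv p.2 (c p.1) * (c j)⁻¹)) = P.eval 0 - P.coeff (2 * n) := by
  let u : Fin n × Bool → ℂ := fun p => signedInv p.2 (c p.1)
  let v : Option (Fin n × Bool) → ℂ := fun o => o.elim 0 u
  have hu0 : ∀ p, u p ≠ 0 := fun p => signedInv_ne_zero (hc0 _) _
  have hu : Function.Injective u := by
    rintro ⟨i, ε⟩ ⟨j, δ⟩ h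
    have hij : ∀ i j, c i = c j → i = j := fun i j h => by_contra fun hne => hc.2 i j hne h
    cases ε <;> cases δ <;> simp only [u, signedInv, if_true, if_false, Bool.false_eq_true] at h
    · rw [hij i j h]
    · exact absurd (by rw [h, inv_mul_cancel₀ (hc0 _)]) (hc.mul_ne_one i j)
    · exact absurd (by rw [← h, mul_inv_cancel₀ (hc0 _)]) (hc.mul_ne_one i j)
    · rw [hij i j (inv_injective h)]
  have hv : Function.Injective v := by
    rintro (_ | p) (_ | r) h
    · rfl
    · exact absurd h.symm (hu0 r)
    · exact absurd h (hu0 p)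
    · rw [hu h]
  have hcard : #(univ : Finset (Option (Fin n × Bool))) = 2 * n + 1 := by
    simp [mul_comm]
  have key := Lagrange.coeff_eq_sum (s := univ) (v := v) hv.injOn (P := P) (by
    rw [hcard]
    exact lt_of_le_of_lt degree_le_natDegree (by exact_mod_cast Nat.lt_succ_of_le hP))
  rw [hcard, Nat.add_sub_cancel, Fintype.sum_option] at key
  have hnone : ∏ j ∈ univ.erase none, (v none - v j) = 1 := by
    have : (univ.erase none : Finset (Option (Fin n × Bool))) =
        univ.map Function.Embedding.some := by
      ext (_ | p) <;> simp
    rw [this, prod_map, Fintype.prod_prod_type]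
    refine prod_eq_one fun i _ => ?_
    simp [v, u, signedInv, hc0 i]
  have hsome : ∀ p, ∏ j ∈ univ.erase (some p), (v (some p) - v j) =
      -((1 - u p ^ 2) * ∏ j ∈ univ.erase p.1, (1 - u p * c j) * (1 - u p * (c j)⁻¹)) := by
    rintro ⟨i, ε⟩
    have : (univ.erase (some (i, ε)) : Finset (Option (Fin n × Bool))) =
        insert none (insert (some (i, !ε))
          (((univ.erase i) ×ˢ univ).map Function.Embedding.some)) := by
      ext (_ | ⟨j, δ⟩)
      · simp
      · by_cases hj : j = i
        · subst hj; cases ε <;> cases δ <;> simp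
        · simp [hj]
    rw [this, prod_insert (by simp), prod_insert (by simp), prod_map, prod_product,
      ← mul_assoc, ← neg_mul]
    congr 1
    · have := hc0 i
      cases ε <;> simp [v, u, signedInv] <;> field_simp
    · refine prod_congr rfl fun j _ => ?_
      have := hc0 j
      simp only [Fintype.prod_bool, Function.Embedding.some_apply, v, Option.elim]
      generalize u (i, ε) = z
      simp only [u, signedInv, if_true, if_false, Bool.false_eq_true]
      field_simp
      ring
  simp only [hnone, hsome, div_neg, sum_neg_distrib, div_one] at key
  simp only [v, u, Option.elim] at key
  rw [key]
  ring

lemma continuousAt_signedInv (ε : Bool) {x : ℂ} (hx : x ≠ 0) : ContinuousAt (signedInv ε) x := by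
  cases ε
  · exact continuousAt_id
  · exact continuousAt_inv₀ hx

/-- The denominator attached to the signed entry `p` of a `B`-regular tuple. -/
lemma BRegular.denom_ne_zero {n : ℕ} {c : Fin n → ℂ} (hc0 : ∀ i, c i ≠ 0) (hc : BRegular n c)
    (p : Fin n × Bool) :
    (1 - signedInv p.2 (c p.1)) * ∏ j ∈ univ.erase p.1, (1 - signedInv p.2 (c p.1) * c j) *
        (1 - signedInv p.2 (c p.1) * (c j)⁻¹) ≠ 0 := by
  obtain ⟨i, ε⟩ := p
  have h1 := hc.1 i
  have hi := hc0 i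
  refine mul_ne_zero ?_ (prod_ne_zero_iff.2 fun j hj => ?_)
  · rw [sub_ne_zero, ne_comm]
    cases ε <;> simpa [signedInv] using h1
  · have hij : i ≠ j := fun h => by simp [h] at hj
    have hj0 := hc0 j
    have h2 := hc.mul_ne_one hij
    have h3 := hc.2.2 i j hij
    rw [mul_ne_zero_iff, sub_ne_zero, sub_ne_zero]
    cases ε <;> simp only [signedInv, if_true, if_false, Bool.false_eq_true]
    · refine ⟨h2.symm, fun h => h3 ?_⟩
      field_simp at h
      exact h.symm
    · refine ⟨fun h => h3 ?_, fun h => h2 ?_⟩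
      · field_simp at h
        exact h
      · field_simp at h
        exact h

lemma sum_eval_div_one_sub {n : ℕ} {c : Fin n → ℂ} (hc0 : ∀ i, c i ≠ 0)
    (hc : BRegular n c) {P : ℂ[X]} (hP : P.natDegree + 1 ≤ 2 * n) :
    ∑ p : Fin n × Bool, P.eval (signedInv p.2 (c p.1)) / ((1 - signedInv p.2 (c p.1)) *
      ∏ j ∈ univ.erase p.1, (1 - signedInv p.2 (c p.1) * c j) *
        (1 - signedInv p.2 (c p.1) * (c j)⁻¹)) = P.eval 0 - P.coeff (2 * n - 1) := by
  have generic : ∀ c : Fin n → ℂ, (∀ i, c i ≠ 0) → BRegular n c → (∀ i, c i ≠ -1) →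
      ∑ p : Fin n × Bool, P.eval (signedInv p.2 (c p.1)) / ((1 - signedInv p.2 (c p.1)) *
        ∏ j ∈ univ.erase p.1, (1 - signedInv p.2 (c p.1) * c j) *
          (1 - signedInv p.2 (c p.1) * (c j)⁻¹)) = P.eval 0 - P.coeff (2 * n - 1) := by
    intro c hc0 hc hneg
    have hGL : GLRegular n c := by
      refine ⟨fun i j _ h => ?_, hc.2.2⟩
      by_cases hij : i = j
      · subst hij
        rcases mul_self_eq_one_iff.1 h with h | h
        · exact hc.1 i h
        · exact hneg i h
      · exact hc.mul_ne_one hij h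
    have hdeg : (P * (X + 1)).natDegree ≤ 2 * n := by
      refine natDegree_mul_le.trans (le_trans ?_ hP)
      gcongr
      exact natDegree_X_add_C (1 : ℂ) |>.le
    have hcoeff : (P * (X + 1)).coeff (2 * n) = P.coeff (2 * n - 1) := by
      obtain ⟨m, hm⟩ : ∃ m, 2 * n = m + 1 := ⟨2 * n - 1, by omega⟩
      rw [hm, mul_add, mul_one, coeff_add, coeff_mul_X,
        coeff_eq_zero_of_natDegree_lt (n := m + 1) (by omega)]
      simp
    have key := sum_eval_div_one_sub_sq hc0 hGL hdeg
    rw [hcoeff] at key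
    simp only [eval_mul, eval_add, eval_X, eval_one, zero_add, mul_one] at key
    rw [← key]
    refine sum_congr rfl fun p _ => ?_
    have hp : signedInv p.2 (c p.1) + 1 ≠ 0 := by
      intro h
      have h' := eq_neg_of_add_eq_zero_left h
      refine hneg p.1 ?_
      cases hε : p.2 <;> simp only [hε, signedInv, if_true, if_false, Bool.false_eq_true] at h'
      · exact h'
      · rw [← inv_inv (c p.1), h']; norm_num
    generalize signedInv p.2 (c p.1) = z at hp ⊢
    rw [show (1 : ℂ) - z ^ 2 = (1 - z) * (z + 1) by ring, mul_right_comm (1 - z),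
      mul_div_mul_right _ _ hp]
  by_cases hneg : ∀ i, c i ≠ -1
  · exact generic c hc0 hc hneg
  push Not at hneg
  obtain ⟨k, hk⟩ := hneg
  let S : (Fin n → ℂ) → ℂ := fun c => ∑ p : Fin n × Bool,
    P.eval (signedInv p.2 (c p.1)) / ((1 - signedInv p.2 (c p.1)) *
      ∏ j ∈ univ.erase p.1, (1 - signedInv p.2 (c p.1) * c j) *
        (1 - signedInv p.2 (c p.1) * (c j)⁻¹))
  have hS : ContinuousAt S c := by
    refine tendsto_finsetSum _ fun p _ => ?_
    have hs : ContinuousAt (fun c : Fin n → ℂ => signedInv p.2 (c p.1)) c :=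
      (continuousAt_signedInv p.2 (hc0 p.1)).comp
        (f := fun c : Fin n → ℂ => c p.1) (continuous_apply p.1).continuousAt
    have hj : ∀ j, ContinuousAt (fun c : Fin n → ℂ => c j) c :=
      fun j => (continuous_apply j).continuousAt
    refine ContinuousAt.div (P.continuous.continuousAt.comp hs) ?_ (hc.denom_ne_zero hc0 p)
    refine (continuousAt_const.sub hs).mul (tendsto_finsetProd _ fun j _ => ?_)
    exact (continuousAt_const.sub (hs.mul (hj j))).mul
      (continuousAt_const.sub (hs.mul ((hj j).inv₀ (hc0 j))))
  have hSk : ContinuousAt (fun z => S (Function.update c k z)) (-1) := by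
    refine ContinuousAt.comp (g := S) (f := fun z => Function.update c k z) ?_
      (continuous_const.update k continuous_id).continuousAt
    rwa [← hk, Function.update_eq_self]
  have hev : ∀ᶠ z in 𝓝[≠] (-1 : ℂ),
      S (Function.update c k z) = P.eval 0 - P.coeff (2 * n - 1) := by
    have hnhds : ∀ w : ℂ, w ≠ -1 → ∀ᶠ z in 𝓝[≠] (-1 : ℂ), z ≠ w := fun w hw =>
      (eventually_ne_nhds hw.symm).filter_mono nhdsWithin_le_nhds
    have hne : ∀ j, j ≠ k → c j ≠ -1 := fun j hj h => hc.2.2 j k hj (h.trans hk.symm)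
    have hj1 : ∀ᶠ z in 𝓝[≠] (-1 : ℂ), ∀ j, j ≠ k → z ≠ c j ∧ z ≠ (c j)⁻¹ := by
      refine Filter.eventually_all.2 fun j => ?_
      by_cases hj : j = k
      · simp [hj]
      filter_upwards [hnhds _ (hne j hj), hnhds (c j)⁻¹ fun h =>
        hne j hj (by rw [← inv_inv (c j), h]; norm_num)] with z h1 h2 _ using ⟨h1, h2⟩
    filter_upwards [hnhds 0 (by norm_num), hnhds 1 (by norm_num), hj1, self_mem_nhdsWithin]
      with z hz0 hz1 hzj hzneg
    refine generic _ (fun i => ?_) ⟨fun i => ?_, fun i j hij => ?_, fun i j hij => ?_⟩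
      fun i => ?_
    · by_cases hi : i = k
      · subst hi; simpa using hz0
      · simpa [hi] using hc0 i
    · by_cases hi : i = k
      · subst hi; simpa using hz1
      · simpa [hi] using hc.1 i
    · have hij := hij.ne
      by_cases hi : i = k
      · subst hi
        simpa [hij.symm] using fun h => (hzj j hij.symm).2 (eq_inv_of_mul_eq_one_left h)
      · by_cases hj : j = k
        · subst hj
          simpa [hij] using fun h => (hzj i hij).2 (eq_inv_of_mul_eq_one_right h)
        · simpa [hi, hj] using hc.mul_ne_one hij
    · by_cases hi : i = k
      · subst hi
        simpa [hij.symm] using (hzj j hij.symm).1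
      · by_cases hj : j = k
        · subst hj
          simpa [hij] using (hzj i hij).1.symm
        · simpa [hi, hj] using hc.2.2 i j hij
    · by_cases hi : i = k
      · subst hi; simpa using hzneg
      · simpa [hi] using hne i hi
  have hlim : S (Function.update c k (-1)) = P.eval 0 - P.coeff (2 * n - 1) :=
    tendsto_nhds_unique_of_eventuallyEq (hSk.tendsto.mono_left nhdsWithin_le_nhds)
      tendsto_const_nhds hev
  rwa [← hk, Function.update_eq_self] at hlim

/-- `pairProd t x c` as a polynomial in `x`. -/
def pairPoly {n : ℕ} (t : ℂ) (c : Fin n → ℂ) : ℂ[X] :=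
  ∏ i, (C (t ^ 2) * X ^ 2 + C (-t * (c i + (c i)⁻¹)) * X + C 1)

lemma eval_pairPoly {n : ℕ} (t x : ℂ) {c : Fin n → ℂ} (hc : ∀ i, c i ≠ 0) :
    (pairPoly t c).eval x = pairProd t x c := by
  rw [pairPoly, pairProd, eval_prod]
  refine prod_congr rfl fun i _ => ?_
  have := hc i
  simp only [eval_add, eval_mul, eval_C, eval_pow, eval_X]
  field_simp
  ring

lemma natDegree_pairPoly_le {n : ℕ} (t : ℂ) (c : Fin n → ℂ) :
    (pairPoly t c).natDegree ≤ 2 * n := by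
  refine (natDegree_prod_le _ _).trans ((sum_le_card_nsmul _ _ 2 fun i _ => ?_).trans ?_)
  · exact natDegree_quadratic_le
  · simp [mul_comm]

lemma coeff_pairPoly {n : ℕ} (t : ℂ) (c : Fin n → ℂ) :
    (pairPoly t c).coeff (2 * n) = t ^ (2 * n) := by
  have h := coeff_prod_of_natDegree_le (s := univ)
    (fun i => C (t ^ 2) * X ^ 2 + C (-t * (c i + (c i)⁻¹)) * X + C (1 : ℂ)) 2
    fun i _ => natDegree_quadratic_le
  rw [card_univ, Fintype.card_fin, mul_comm n] at h
  rw [pairPoly, h]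
  simp [coeff_one, pow_mul, -map_pow]

lemma sum_pairProd_div_one_sub_sq {n : ℕ} (t : ℂ) {a b : Fin (n + 1) → ℂ} (ha0 : ∀ i, a i ≠ 0)
    (hb0 : ∀ i, b i ≠ 0) (ha : GLRegular (n + 1) a) :
    ∑ p : Fin (n + 1) × Bool, pairProd t (signedInv p.2 (a p.1)) b /
      ((1 - signedInv p.2 (a p.1) ^ 2) * pairProd 1 (signedInv p.2 (a p.1)) (dropAt p.1 a)) =
      1 - t ^ (2 * n + 2) := by
  have key := sum_eval_div_one_sub_sq ha0 ha (natDegree_pairPoly_le t b)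
  simp only [eval_pairPoly t _ hb0, coeff_pairPoly] at key
  calc _ = _ := sum_congr rfl fun p _ => ?_
    _ = _ := key
    _ = _ := by simp [pairProd, mul_add]
  rw [← prod_dropAt p.1 a fun z => (1 - signedInv p.2 (a p.1) * z) *
    (1 - signedInv p.2 (a p.1) * z⁻¹)]
  simp only [pairProd, one_mul]

lemma sum_pairProd_div_one_sub {n : ℕ} (t : ℂ) {a : Fin n → ℂ} {b : Fin (n + 1) → ℂ}
    (ha0 : ∀ i, a i ≠ 0) (hb0 : ∀ i, b i ≠ 0) (hb : BRegular (n + 1) b) :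
    ∑ r : Fin (n + 1) × Bool,
      (1 - t * signedInv r.2 (b r.1)) * pairProd t (signedInv r.2 (b r.1)) a /
        ((1 - signedInv r.2 (b r.1)) * pairProd 1 (signedInv r.2 (b r.1)) (dropAt r.1 b)) =
      1 + t ^ (2 * n + 1) := by
  have hlin : (C (-t) * X + C 1 : ℂ[X]).natDegree ≤ 1 := natDegree_linear_le
  have hdeg : ((C (-t) * X + C 1) * pairPoly t a).natDegree + 1 ≤ 2 * (n + 1) := by
    have := natDegree_mul_le (p := C (-t) * X + C 1) (q := pairPoly t a)
    have := natDegree_pairPoly_le t a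
    omega
  have hcoeff : ((C (-t) * X + C 1) * pairPoly t a).coeff (2 * (n + 1) - 1) =
      -t ^ (2 * n + 1) := by
    rw [show 2 * (n + 1) - 1 = 1 + 2 * n by omega,
      coeff_mul_add_eq_of_natDegree_le hlin (natDegree_pairPoly_le t a), coeff_pairPoly]
    simp only [coeff_add, coeff_C_mul, coeff_X_one, coeff_C_succ]
    ring
  have key := sum_eval_div_one_sub hb0 hb hdeg
  rw [hcoeff] at key
  simp only [eval_mul, eval_pairPoly t _ ha0, eval_add, eval_C, eval_X] at key
  calc _ = _ := sum_congr rfl fun r _ => ?_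
    _ = _ := key
    _ = _ := by simp [pairProd]
  rw [← prod_dropAt r.1 b fun z => (1 - signedInv r.2 (b r.1) * z) *
    (1 - signedInv r.2 (b r.1) * z⁻¹)]
  simp only [pairProd, one_mul]
  ring_nf

/-- The evaluation of `AA`, valid for every value of `t`. -/
lemma AA_eq_prod (t : ℂ) : ∀ (l : ℕ) (a b : Fin l → ℂ), (∀ i, a i ≠ 0) → (∀ i, b i ≠ 0) →
    GLRegular l a → BRegular l b →
    AA l t a b = ∏ k ∈ range l, ((1 + t ^ (2 * k + 1)) * (1 - t ^ (2 * k + 2)))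
  | 0, a, b, _, _, _, _ => by
    simp [AA, cA, bA, d1A, d0A]
  | n + 1, a, b, ha0, hb0, ha, hb => by
    have ih := fun p r => AA_eq_prod t n (dropAt p a) (dropAt r b) (fun _ => ha0 _)
      (fun _ => hb0 _) (ha.dropAt p) (hb.dropAt r)
    have hinner := fun p => sum_pairProd_div_one_sub t (a := dropAt p a) (fun _ => ha0 _) hb0 hb
    rw [AA_succ, prod_range_succ]
    simp only [ih, ← sum_mul, hinner]
    rw [sum_pairProd_div_one_sub_sq t ha0 hb0 ha]
    ring

/-- Case A of the paper's Proposition: for any regular pair, the Weyl-group sum equals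
`∏_{k=1}^{l} (1 + t^{2k-1})(1 - t^{2k})`, i.e. `(L(1,χ)ζ(2)⋯L(2l-1,χ)ζ(2l))⁻¹` with
respect to `q_F = t⁻¹`. -/
theorem stmt6 (l : ℕ) (hl : 1 ≤ l) (q : ℝ) (hq : 1 < q) (t : ℂ)
    (ht : t = ((Real.sqrt q)⁻¹ : ℝ))
    (a b : Fin l → ℂ) (ha0 : ∀ i, a i ≠ 0) (hb0 : ∀ i, b i ≠ 0)
    (ha : GLRegular l a) (hb : BRegular l b) :
    AA l t a b = ∏ k ∈ Finset.range l, ((1 + t ^ (2 * k + 1)) * (1 - t ^ (2 * k + 2))) := by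
  exact AA_eq_prod t l a b ha0 hb0 ha hb

end GrossPrasadCaseA
end
end
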